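/- Let N ≥ 2, let B ⊂ ℝ^N be the open unit ball, and let ρ : B → (0,∞) be continuous, defining the conformal metric g_ρ = ρ g_e on B. Then the following are equivalent: (1) there exists C > 0 such that ρ(x) ≤ C/(1 − |x|²)² for all x ∈ B; (2) the Moser–Trudinger inequality holds for (B, g_ρ), i.e. (using the conformal invariance of the N-Dirichlet energy to express all quantities in Euclidean terms) sup { ∫_B Φ(u(x)) ρ(x)^{N/2} dx : u ∈ C_c^∞(B), ∫_B |∇u(x)|^N dx ≤ 1 } < +∞. -/

import Mathlib

open MeasureTheory Real

/-- `ω_{N-1}`, the `(N-1)`-dimensional measure of the unit sphere in `ℝ^N`. -/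
noncomputable def sphereVol (N : ℕ) : ℝ :=
  N * Real.pi ^ ((N : ℝ) / 2) / Real.Gamma ((N : ℝ) / 2 + 1)

/-- `α_N := N ω_{N-1}^{1/(N-1)}`. -/
noncomputable def alphaMT (N : ℕ) : ℝ := N * sphereVol N ^ ((1 : ℝ) / ((N : ℝ) - 1))

/-- `Φ(t) := e^{α_N |t|^{N/(N-1)}} - ∑_{j=0}^{N-2} α_N^j |t|^{jN/(N-1)} / j!`. -/
noncomputable def PhiMT (N : ℕ) (t : ℝ) : ℝ :=
  Real.exp (alphaMT N * |t| ^ ((N : ℝ) / ((N : ℝ) - 1))) -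
    ∑ j ∈ Finset.range (N - 1),
      alphaMT N ^ j * |t| ^ ((j : ℝ) * N / ((N : ℝ) - 1)) / (Nat.factorial j : ℝ)

/-- The open unit ball of `ℝ^N`. -/
noncomputable def unitBall (N : ℕ) : Set (EuclideanSpace ℝ (Fin N)) := Metric.ball 0 1

/-- `u ∈ C_c^∞(Ω)`: smooth, compactly supported, with support contained in `Ω`. -/
def IsTest {N : ℕ} (Ω : Set (EuclideanSpace ℝ (Fin N)))
    (u : EuclideanSpace ℝ (Fin N) → ℝ) : Prop :=
  ContDiff ℝ (⊤ : ℕ∞) u ∧ HasCompactSupport u ∧ tsupport u ⊆ Ω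

section MTHelpers

open Set Metric ENNReal

namespace MT

abbrev MTE (n : ℕ) := EuclideanSpace ℝ (Fin (n + 1))

/-- Polar coordinates for nonnegative functions. -/
theorem polar (n : ℕ) (f : MTE n → ℝ≥0∞) (hf : Measurable f) :
    ∫⁻ x, f x = ∫⁻ θ : sphere (0 : MTE n) 1,
      (∫⁻ r in Ioi (0 : ℝ), ENNReal.ofReal (r ^ n) * f (r • (θ : MTE n)))
        ∂((volume : Measure (MTE n)).toSphere) := by
  have h0 : ∫⁻ x, f x = ∫⁻ x in ({0}ᶜ : Set (MTE n)), f x := by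
    rw [restrict_compl_singleton]
  have h1 : ∫⁻ x in ({0}ᶜ : Set (MTE n)), f x
      = ∫⁻ x : ({0}ᶜ : Set (MTE n)), f x ∂(Measure.comap Subtype.val volume) := by
    rw [lintegral_subtype_comap (measurableSet_singleton _).compl]
  have h2 := (Measure.measurePreserving_homeomorphUnitSphereProd
    (volume : Measure (MTE n))).lintegral_comp_emb
      (Homeomorph.measurableEmbedding _)
      (fun q : sphere (0 : MTE n) 1 × Ioi (0 : ℝ) => f ((q.2 : ℝ) • (q.1 : MTE n)))
  have hm : Measurable (fun q : sphere (0 : MTE n) 1 × Ioi (0 : ℝ) =>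
      f ((q.2 : ℝ) • (q.1 : MTE n))) := by
    apply hf.comp
    fun_prop
  rw [h0, h1]
  have h3 : ∀ x : ({0}ᶜ : Set (MTE n)), f x = f
     (((homeomorphUnitSphereProd (MTE n) x).2 : ℝ) •
      ((homeomorphUnitSphereProd (MTE n) x).1 : MTE n)) := by
    intro x
    congr 1
    have hx : ‖(x : MTE n)‖ ≠ 0 := norm_ne_zero_iff.2 x.2
    simp [smul_smul, hx]
  rw [lintegral_congr h3, h2, lintegral_prod _ hm.aemeasurable]
  have hd : Module.finrank ℝ (MTE n) - 1 = n := by simp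
  refine lintegral_congr fun θ => ?_
  rw [hd, Measure.volumeIoiPow, lintegral_withDensity_eq_lintegral_mul _ (by fun_prop)
    (by fun_prop)]
  exact lintegral_subtype_comap measurableSet_Ioi
    (fun r : ℝ => ENNReal.ofReal (r ^ n) * f (r • (θ : MTE n)))

/-- Radial functions. -/
theorem polar_radial (n : ℕ) (g : ℝ → ℝ≥0∞) (hg : Measurable g) :
    ∫⁻ x : MTE n, g ‖x‖ = (∫⁻ r in Ioi (0 : ℝ), ENNReal.ofReal (r ^ n) * g r) *
      (volume : Measure (MTE n)).toSphere univ := by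
  rw [polar n (fun x => g ‖x‖) (hg.comp measurable_norm), ← lintegral_const]
  refine lintegral_congr fun θ => ?_
  refine setLIntegral_congr_fun measurableSet_Ioi fun r hr => ?_
  have hr' : (0:ℝ) < r := hr
  simp [norm_smul, abs_of_pos hr']

theorem sphere_total (n : ℕ) :
    (volume : Measure (MTE n)).toSphere univ = ENNReal.ofReal (sphereVol (n + 1)) := by
  rw [Measure.toSphere_apply_univ, EuclideanSpace.volume_ball]
  simp only [finrank_euclideanSpace, Fintype.card_fin, ENNReal.ofReal_one, one_pow, one_mul]
  rw [← ENNReal.ofReal_natCast, ← ENNReal.ofReal_mul (by positivity)]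
  congr 1
  rw [sphereVol, mul_div_assoc]
  congr 2
  rw [Real.sqrt_eq_rpow, ← Real.rpow_natCast, ← Real.rpow_mul Real.pi_pos.le]
  congr 1
  push_cast; ring

theorem sphereVol_pos (n : ℕ) : 0 < sphereVol (n + 1) := by
  unfold sphereVol
  have : 0 < Real.Gamma (((n + 1 : ℕ) : ℝ) / 2 + 1) := Real.Gamma_pos_of_pos (by positivity)
  have := Real.pi_pos
  positivity

/-- The ray inequality. -/
theorem ray_ineq (n : ℕ) (v : MTE n → ℝ) (hv : ContDiffOn ℝ 1 v (ball 0 1)) (R : ℝ)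
    (hR0 : 0 < R) (hR : R < 1) (hvR : ∀ z ∈ ball (0 : MTE n) 1, R ≤ ‖z‖ → v z = 0) :
    ENNReal.ofReal (sphereVol (n + 1)) * ‖v 0‖ₑ ≤
      ∫⁻ z in ball (0 : MTE n) 1, ‖fderiv ℝ v z‖ₑ * ENNReal.ofReal ((‖z‖ ^ n)⁻¹) := by
  have hcont : ContinuousOn (fderiv ℝ v) (ball 0 1) :=
    hv.continuousOn_fderiv_of_isOpen isOpen_ball le_rfl
  have hmeas : Measurable (fun z : MTE n => (ball (0 : MTE n) 1).indicator
      (fun z => ‖fderiv ℝ v z‖ₑ * ENNReal.ofReal ((‖z‖ ^ n)⁻¹)) z) := by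
    refine Measurable.indicator ?_ measurableSet_ball
    exact ((measurable_fderiv ℝ v).enorm).mul (by fun_prop)
  rw [← lintegral_indicator measurableSet_ball, polar n _ hmeas, ← sphere_total, mul_comm,
    ← lintegral_const]
  refine lintegral_mono fun θ => ?_
  have hθ : ‖(θ : MTE n)‖ = 1 := by simp
  have hmem : ∀ r ∈ Icc (0:ℝ) R, r • (θ : MTE n) ∈ ball (0 : MTE n) 1 := by
    intro r hr
    simp [norm_smul, hθ, abs_of_nonneg hr.1]
    linarith [hr.2]
  have hder : ∀ r ∈ Icc (0:ℝ) R, HasDerivAt (fun r : ℝ => v (r • (θ : MTE n)))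
      (fderiv ℝ v (r • (θ : MTE n)) (θ : MTE n)) r := by
    intro r hr
    have h1 : DifferentiableAt ℝ v (r • (θ : MTE n)) :=
      (hv.differentiableOn one_ne_zero).differentiableAt (isOpen_ball.mem_nhds (hmem r hr))
    have h2 : HasDerivAt (fun r : ℝ => r • (θ : MTE n)) (θ : MTE n) r := by
      simpa using (hasDerivAt_id r).smul_const (θ : MTE n)
    exact h1.hasFDerivAt.comp_hasDerivAt r h2
  have hc : ContinuousOn (fun r : ℝ => fderiv ℝ v (r • (θ : MTE n)) (θ : MTE n)) (Icc 0 R) := by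
    refine ContinuousOn.clm_apply (hcont.comp (by fun_prop) fun r hr => hmem r hr)
      continuousOn_const
  have hintg : IntervalIntegrable (fun r : ℝ => fderiv ℝ v (r • (θ : MTE n)) (θ : MTE n))
      volume 0 R := by
    apply ContinuousOn.intervalIntegrable
    rwa [uIcc_of_le hR0.le]
  have hftc := intervalIntegral.integral_eq_sub_of_hasDerivAt
    (fun r hr => hder r (by rwa [uIcc_of_le hR0.le] at hr)) hintg
  have hvR0 : v (R • (θ : MTE n)) = 0 :=
    hvR _ (hmem R ⟨hR0.le, le_rfl⟩) (by simp [norm_smul, hθ, abs_of_pos hR0])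
  rw [hvR0, zero_smul, zero_sub] at hftc
  have : ‖v 0‖ₑ ≤ ∫⁻ r in Ioc (0:ℝ) R, ‖fderiv ℝ v (r • (θ : MTE n)) (θ : MTE n)‖ₑ := by
    rw [← enorm_neg, ← hftc, intervalIntegral.integral_of_le hR0.le]
    exact enorm_integral_le_lintegral_enorm _
  refine this.trans ?_
  refine (lintegral_mono_set (fun r hr => hr.1 : Ioc (0:ℝ) R ⊆ Ioi 0)).trans' ?_
  refine setLIntegral_mono' measurableSet_Ioc fun r hr => ?_
  rw [indicator_of_mem (hmem r ⟨hr.1.le, hr.2⟩)]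
  have hn : ‖r • (θ : MTE n)‖ = r := by simp [norm_smul, hθ, abs_of_pos hr.1]
  rw [hn, mul_comm (ENNReal.ofReal _), mul_assoc, ← ENNReal.ofReal_mul (by have := hr.1; positivity),
    inv_mul_cancel₀ (by have := hr.1; positivity), ENNReal.ofReal_one, mul_one]
  rw [← ofReal_norm, ← ofReal_norm]
  apply ENNReal.ofReal_le_ofReal
  simpa [hθ] using (fderiv ℝ v (r • (θ : MTE n))).le_opNorm (θ : MTE n)

end MT

namespace MT

/-- `[x,y]^2`. -/
noncomputable def br {n : ℕ} (x y : MTE n) : ℝ := 1 - 2 * inner ℝ x y + ‖x‖ ^ 2 * ‖y‖ ^ 2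

/-- Pseudo-hyperbolic distance. -/
noncomputable def dd {n : ℕ} (x y : MTE n) : ℝ :=
  √(1 - (1 - ‖x‖ ^ 2) * (1 - ‖y‖ ^ 2) / br x y)

theorem dd_comm {n : ℕ} (x y : MTE n) : dd x y = dd y x := by
  unfold dd br
  rw [real_inner_comm]
  ring_nf

theorem measurable_dd {n : ℕ} : Measurable (fun q : MTE n × MTE n => dd q.1 q.2) := by
  unfold dd br
  fun_prop

theorem measurable_dd_right {n : ℕ} (x : MTE n) : Measurable (fun y : MTE n => dd x y) := by
  unfold dd br
  fun_prop

theorem abs_det_isom {n : ℕ} (L : MTE n ≃ₗᵢ[ℝ] MTE n) :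
    |((L : MTE n ≃L[ℝ] MTE n) : MTE n →L[ℝ] MTE n).det| = 1 := by
  have h := Measure.addHaar_image_continuousLinearMap (volume : Measure (MTE n))
    ((L : MTE n ≃L[ℝ] MTE n) : MTE n →L[ℝ] MTE n) (ball 0 1)
  have h1 : Set.image ((L : MTE n ≃L[ℝ] MTE n) : MTE n →L[ℝ] MTE n) (ball 0 1) = ball 0 1 := by
    simp
  rw [h1] at h
  have hpos : volume (ball (0 : MTE n) 1) ≠ 0 := (measure_ball_pos _ _ one_pos).ne'
  have hfin : volume (ball (0 : MTE n) 1) ≠ ∞ := measure_ball_lt_top.ne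
  have h2 : ENNReal.ofReal |((L : MTE n ≃L[ℝ] MTE n) : MTE n →L[ℝ] MTE n).det| = 1 := by
    have : 1 * volume (ball (0 : MTE n) 1) = ENNReal.ofReal
      |((L : MTE n ≃L[ℝ] MTE n) : MTE n →L[ℝ] MTE n).det| * volume (ball (0 : MTE n) 1) := by
      rw [one_mul]; exact h
    exact ((ENNReal.mul_left_inj hpos hfin).1 this).symm
  simpa using h2

structure IsMob {n : ℕ} (x : MTE n) (T : MTE n → MTE n) (J : MTE n → ℝ) : Prop where
  zero : T 0 = x
  maps : ∀ y ∈ ball (0 : MTE n) 1, T y ∈ ball (0 : MTE n) 1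
  inv : ∀ y ∈ ball (0 : MTE n) 1, T (T y) = y
  pos : ∀ y ∈ ball (0 : MTE n) 1, 0 < J y
  der : ∀ y ∈ ball (0 : MTE n) 1, ∃ L : MTE n ≃ₗᵢ[ℝ] MTE n,
    HasFDerivAt T (J y • ((L : MTE n ≃L[ℝ] MTE n) : MTE n →L[ℝ] MTE n)) y
  conf : ∀ y ∈ ball (0 : MTE n) 1, 1 - ‖T y‖ ^ 2 = J y * (1 - ‖y‖ ^ 2)
  dist : ∀ y ∈ ball (0 : MTE n) 1, ‖T y‖ = dd x y
  smooth : ContDiffOn ℝ 1 T (ball 0 1)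

theorem norm_sq_lt {n : ℕ} {x : MTE n} (hx : x ∈ ball (0 : MTE n) 1) : 0 < 1 - ‖x‖ ^ 2 := by
  have h : ‖x‖ < 1 := by simpa using hx
  nlinarith [norm_nonneg x]

theorem exists_mob {n : ℕ} (x : MTE n) (hx : x ∈ ball (0 : MTE n) 1) :
    ∃ T J, IsMob x T J := by
  have hx1 := norm_sq_lt hx
  by_cases h0 : x = 0
  · subst h0
    refine ⟨id, fun _ => 1, rfl, fun y hy => hy, fun y _ => rfl, fun _ _ => one_pos,
      fun y _ => ⟨LinearIsometryEquiv.refl ℝ _, ?_⟩, fun y _ => by simp, fun y _ => ?_,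
      contDiffOn_id⟩
    · rw [one_smul]; exact hasFDerivAt_id y
    · simp [dd, br]
  · have hxn : 0 < ‖x‖ := norm_pos_iff.2 h0
    set c : MTE n := (‖x‖ ^ 2)⁻¹ • x with hc
    set R : ℝ := √((1 - ‖x‖ ^ 2) / ‖x‖ ^ 2) with hR
    have hR2 : R ^ 2 = (1 - ‖x‖ ^ 2) / ‖x‖ ^ 2 := Real.sq_sqrt (by positivity)
    have hRpos : 0 < R := Real.sqrt_pos.2 (by positivity)
    have hcn : ‖c‖ ^ 2 = 1 / ‖x‖ ^ 2 := by
      rw [hc, norm_smul, norm_inv, norm_pow, norm_norm]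
      field_simp
    have hcR : ‖c‖ ^ 2 = R ^ 2 + 1 := by
      rw [hcn, hR2]; field_simp; ring
    have hyc : ∀ y ∈ ball (0 : MTE n) 1, y ≠ c := by
      rintro y hy rfl
      have := norm_sq_lt hy
      rw [hcR] at this
      nlinarith [sq_nonneg R]
    set T := EuclideanGeometry.inversion c R with hT
    have hTy : ∀ y, T y = c + (R / dist y c) ^ 2 • (y - c) := by
      intro y; simp [hT, EuclideanGeometry.inversion, add_comm]
    have hinv : ∀ y, T (T y) = y := EuclideanGeometry.inversion_inversion c hRpos.ne'
    have hconf : ∀ y ∈ ball (0 : MTE n) 1,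
        1 - ‖T y‖ ^ 2 = (R / dist y c) ^ 2 * (1 - ‖y‖ ^ 2) := by
      intro y hy
      have hd : 0 < dist y c := dist_pos.2 (hyc y hy)
      set J := (R / dist y c) ^ 2 with hJ
      have hJ1 : J * ‖y - c‖ ^ 2 = R ^ 2 := by
        rw [hJ, ← dist_eq_norm]; field_simp
      have e1 : ‖T y‖ ^ 2 = ‖c‖ ^ 2 + 2 * (J * inner ℝ c (y - c)) + J ^ 2 * ‖y - c‖ ^ 2 := by
        rw [hTy, norm_add_sq_real, inner_smul_right, ← hJ, norm_smul J, mul_pow, Real.norm_eq_abs,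
          sq_abs]
      have e2 : inner ℝ c (y - c) = inner ℝ y c - ‖c‖ ^ 2 := by
        rw [inner_sub_right, real_inner_comm, real_inner_self_eq_norm_sq]
      have e3 : ‖y - c‖ ^ 2 = ‖y‖ ^ 2 - 2 * inner ℝ y c + ‖c‖ ^ 2 := norm_sub_sq_real y c
      rw [e1, e2]
      have e4 : J ^ 2 * ‖y - c‖ ^ 2 = J * R ^ 2 := by rw [← hJ1]; ring
      rw [e3] at hJ1
      rw [e4]
      linear_combination (-1 + J) * hcR + hJ1
    have hpos : ∀ y ∈ ball (0 : MTE n) 1, 0 < (R / dist y c) ^ 2 := by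
      intro y hy
      have hd : 0 < dist y c := dist_pos.2 (hyc y hy)
      positivity
    refine ⟨T, fun y => (R / dist y c) ^ 2, ?_, ?_, fun y _ => hinv y, hpos, ?_, hconf, ?_, ?_⟩
    · rw [hTy]
      have : (R / dist 0 c) ^ 2 = 1 - ‖x‖ ^ 2 := by
        rw [dist_zero_left, div_pow, hcn, hR2]; field_simp
      rw [this, zero_sub, smul_neg, ← sub_eq_add_neg, hc, smul_smul, ← sub_smul]
      have : (‖x‖ ^ 2)⁻¹ - (1 - ‖x‖ ^ 2) * (‖x‖ ^ 2)⁻¹ = 1 := by field_simp; ring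
      rw [this, one_smul]
    · intro y hy
      have h1 := hconf y hy
      have h2 := mul_pos (hpos y hy) (norm_sq_lt hy)
      have : ‖T y‖ < 1 := by
        by_contra hcon
        push Not at hcon
        nlinarith
      simpa using this
    · intro y hy
      exact ⟨_, EuclideanGeometry.hasFDerivAt_inversion (hyc y hy)⟩
    · intro y hy
      have h1 := hconf y hy
      have hd : 0 < dist y c := dist_pos.2 (hyc y hy)
      have hb : dist y c ^ 2 * ‖x‖ ^ 2 = br x y := by
        rw [dist_eq_norm, norm_sub_sq_real, hcn, hc, inner_smul_right, br, real_inner_comm]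
        field_simp
        ring
      have hJ : (R / dist y c) ^ 2 = (1 - ‖x‖ ^ 2) / br x y := by
        rw [← hb, div_pow, hR2]; field_simp
      rw [dd, ← Real.sqrt_sq (norm_nonneg (T y))]
      congr 1
      rw [hJ] at h1
      rw [mul_div_right_comm]
      linarith
    · exact ContDiffOn.inversion contDiffOn_const contDiffOn_const contDiffOn_id hyc

/-- Hyperbolic measure (up to a constant). -/
noncomputable def mm (n : ℕ) : Measure (MTE n) :=
  ((volume : Measure (MTE n)).restrict (ball 0 1)).withDensity
    (fun y => ENNReal.ofReal (((1 - ‖y‖ ^ 2) ^ (n + 1))⁻¹))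

theorem lintegral_mm {n : ℕ} (g : MTE n → ℝ≥0∞) (hg : Measurable g) :
    ∫⁻ y, g y ∂(mm n) = ∫⁻ y in ball (0 : MTE n) 1,
      ENNReal.ofReal (((1 - ‖y‖ ^ 2) ^ (n + 1))⁻¹) * g y := by
  rw [mm, lintegral_withDensity_eq_lintegral_mul _ (by fun_prop) hg]
  rfl

instance {n : ℕ} : SFinite (mm n) := by unfold mm; infer_instance

theorem IsMob.surj {n : ℕ} {x : MTE n} {T J} (h : IsMob x T J) :
    Set.image T (ball (0 : MTE n) 1) = ball (0 : MTE n) 1 := by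
  ext z
  constructor
  · rintro ⟨y, hy, rfl⟩; exact h.maps y hy
  · intro hz; exact ⟨T z, h.maps z hz, h.inv z hz⟩

theorem IsMob.changeVar {n : ℕ} {x : MTE n} {T J} (h : IsMob x T J) (g : MTE n → ℝ≥0∞) :
    ∫⁻ y in ball (0 : MTE n) 1, g y =
      ∫⁻ y in ball (0 : MTE n) 1, ENNReal.ofReal (J y ^ (n + 1)) * g (T y) := by
  have hinj : InjOn T (ball 0 1) := by
    intro a ha b hb hab
    rw [← h.inv a ha, ← h.inv b hb, hab]
  choose! L hL using h.der
  have := lintegral_image_eq_lintegral_abs_det_fderiv_mul (volume : Measure (MTE n))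
    measurableSet_ball (fun y hy => (hL y hy).hasFDerivWithinAt) hinj g
  rw [h.surj] at this
  rw [this]
  refine setLIntegral_congr_fun measurableSet_ball fun y hy => ?_
  have hdet : |(J y • (((L y) : MTE n ≃L[ℝ] MTE n) : MTE n →L[ℝ] MTE n)).det| = J y ^ (n + 1) := by
    have h1 := abs_det_isom (L y)
    rw [ContinuousLinearMap.det] at h1 ⊢
    rw [ContinuousLinearMap.toLinearMap_smul, LinearMap.det_smul, abs_mul, h1, mul_one,
      abs_of_nonneg (by have := (h.pos y hy).le; positivity)]
    simp
  simp only [hdet]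

theorem IsMob.invariance {n : ℕ} {x : MTE n} {T J} (h : IsMob x T J) (g : MTE n → ℝ≥0∞) :
    ∫⁻ y in ball (0 : MTE n) 1, ENNReal.ofReal (((1 - ‖y‖ ^ 2) ^ (n + 1))⁻¹) * g y
     = ∫⁻ y in ball (0 : MTE n) 1,
      ENNReal.ofReal (((1 - ‖y‖ ^ 2) ^ (n + 1))⁻¹) * g (T y) := by
  rw [h.changeVar]
  refine setLIntegral_congr_fun measurableSet_ball fun y hy => ?_
  have hJ := h.pos y hy
  have h1 := norm_sq_lt hy
  rw [← mul_assoc, ← ENNReal.ofReal_mul (by positivity), h.conf y hy, mul_pow]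
  congr 2
  field_simp

/-- Kernel. -/
noncomputable def kap (n : ℕ) (r : ℝ) : ℝ := ((1 - r ^ 2) / r) ^ n

theorem measurable_kap (n : ℕ) : Measurable (kap n) := by unfold kap; fun_prop

theorem IsMob.exists_radius {n : ℕ} {x : MTE n} {T J} (h : IsMob x T J) (w : MTE n → ℝ)
    (hc : HasCompactSupport w) (hs : tsupport w ⊆ ball 0 1) :
    ∃ R, 0 < R ∧ R < 1 ∧ ∀ z ∈ ball (0 : MTE n) 1, R ≤ ‖z‖ → (w ∘ T) z = 0 := by
  have hK : IsCompact (Set.image T (tsupport w)) := hc.isCompact.image_of_continuousOn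
    (h.smooth.continuousOn.mono hs)
  rcases (Set.image T (tsupport w)).eq_empty_or_nonempty with he | hne
  · refine ⟨1/2, by norm_num, by norm_num, fun z hz _ => ?_⟩
    refine image_eq_zero_of_notMem_tsupport (f := w) fun hmem => ?_
    have : T (T z) ∈ Set.image T (tsupport w) := mem_image_of_mem _ hmem
    rw [he] at this
    exact this
  · obtain ⟨z0, hz0, hmax⟩ := hK.exists_isMaxOn hne continuous_norm.continuousOn
    have hz0' : ‖z0‖ < 1 := by
      obtain ⟨y, hy, rfl⟩ := hz0
      simpa using h.maps y (hs hy)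
    refine ⟨(‖z0‖ + 1) / 2, by positivity, by linarith, fun z hz hzR => ?_⟩
    refine image_eq_zero_of_notMem_tsupport (f := w) fun hmem => ?_
    have h1 : T (T z) ∈ Set.image T (tsupport w) := mem_image_of_mem _ hmem
    rw [h.inv z hz] at h1
    have : ‖z‖ ≤ ‖z0‖ := hmax h1
    linarith

theorem IsMob.pointwise {n : ℕ} {x : MTE n} {T J} (h : IsMob x T J) (w : MTE n → ℝ)
    (hw : ContDiff ℝ 1 w) (z : MTE n) (hz : z ∈ ball (0 : MTE n) 1) :
    ‖fderiv ℝ (w ∘ T) z‖ₑ * ENNReal.ofReal ((‖z‖ ^ n)⁻¹) =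
      ENNReal.ofReal (((1 - ‖z‖ ^ 2) ^ (n + 1))⁻¹) *
      ((‖fderiv ℝ w (T z)‖ₑ * ENNReal.ofReal (1 - ‖T z‖ ^ 2)) *
        ENNReal.ofReal (kap n (dd x (T z)))) := by
  obtain ⟨L, hL⟩ := h.der z hz
  have hJ := h.pos z hz
  have hTz := h.maps z hz
  have h1 := norm_sq_lt hz
  have hd : dd x (T z) = ‖z‖ := by
    rw [← h.dist _ hTz, h.inv z hz]
  have hfd : fderiv ℝ (w ∘ T) z =
      (fderiv ℝ w (T z)).comp (J z • ((L : MTE n ≃L[ℝ] MTE n) : MTE n →L[ℝ] MTE n)) :=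
    ((hw.differentiable one_ne_zero (T z)).hasFDerivAt.comp z hL).fderiv
  have hnorm : ‖fderiv ℝ (w ∘ T) z‖ = J z * ‖fderiv ℝ w (T z)‖ := by
    rw [hfd, ContinuousLinearMap.comp_smul, norm_smul, Real.norm_of_nonneg hJ.le]
    congr 1
    exact ContinuousLinearMap.opNorm_comp_linearIsometryEquiv _ L
  rw [hd, h.conf z hz, kap, div_pow, ← ofReal_norm, ← ofReal_norm, hnorm]
  have hJ0 := hJ.le
  have h10 := h1.le
  have hF : 0 ≤ ‖fderiv ℝ w (T z)‖ := norm_nonneg _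
  generalize ‖fderiv ℝ w (T z)‖ = F at *
  generalize 1 - ‖z‖ ^ 2 = a at *
  generalize J z = j at *
  rw [← ENNReal.ofReal_mul (by positivity), ← ENNReal.ofReal_mul (by positivity),
    ← ENNReal.ofReal_mul (by positivity), ← ENNReal.ofReal_mul (by positivity)]
  congr 1
  rw [pow_succ]
  field_simp

theorem representation {n : ℕ} (w : MTE n → ℝ) (hw : ContDiff ℝ 1 w)
    (hc : HasCompactSupport w) (hs : tsupport w ⊆ ball 0 1) (x : MTE n)
    (hx : x ∈ ball (0 : MTE n) 1) :
    ENNReal.ofReal (sphereVol (n + 1)) * ‖w x‖ₑ ≤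
      ∫⁻ y, (‖fderiv ℝ w y‖ₑ * ENNReal.ofReal (1 - ‖y‖ ^ 2)) *
        ENNReal.ofReal (kap n (dd x y)) ∂(mm n) := by
  obtain ⟨T, J, h⟩ := exists_mob x hx
  have hk := measurable_kap n
  have hdx : Measurable (fun y => dd x y) := measurable_dd_right x
  have hmeas : Measurable (fun y => (‖fderiv ℝ w y‖ₑ * ENNReal.ofReal (1 - ‖y‖ ^ 2)) *
        ENNReal.ofReal (kap n (dd x y))) :=
    ((measurable_fderiv ℝ w).enorm.mul (by fun_prop)).mul (hk.comp hdx).ennreal_ofReal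
  have hv : ContDiffOn ℝ 1 (w ∘ T) (ball 0 1) := hw.comp_contDiffOn h.smooth
  obtain ⟨R, hR0, hR1, hR⟩ := h.exists_radius w hc hs
  have hray := ray_ineq n (w ∘ T) hv R hR0 hR1 hR
  rw [Function.comp_apply, h.zero] at hray
  refine hray.trans (le_of_eq ?_)
  rw [lintegral_mm _ hmeas, h.invariance]
  exact setLIntegral_congr_fun measurableSet_ball fun z hz => h.pointwise w hw z hz

end MT

namespace MT

theorem ae_mem_ball (n : ℕ) : ∀ᵐ y ∂(mm n), y ∈ ball (0 : MTE n) 1 :=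
  (withDensity_absolutelyContinuous _ _).ae_le (ae_restrict_mem measurableSet_ball)

theorem radial_mm {n : ℕ} (x : MTE n) (hx : x ∈ ball (0 : MTE n) 1) (g : ℝ → ℝ≥0∞)
    (hg : Measurable g) :
    ∫⁻ y, g (dd x y) ∂(mm n) = (∫⁻ r in Ioo (0:ℝ) 1,
      ENNReal.ofReal (r ^ n * ((1 - r ^ 2) ^ (n + 1))⁻¹) * g r) *
        ENNReal.ofReal (sphereVol (n + 1)) := by
  obtain ⟨T, J, h⟩ := exists_mob x hx
  rw [lintegral_mm (fun y => g (dd x y)) (hg.comp (measurable_dd_right x)), h.invariance]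
  have h1 : ∫⁻ y in ball (0 : MTE n) 1,
      ENNReal.ofReal (((1 - ‖y‖ ^ 2) ^ (n + 1))⁻¹) * g (dd x (T y)) =
      ∫⁻ y : MTE n, (Iio (1:ℝ)).indicator
        (fun r => ENNReal.ofReal (((1 - r ^ 2) ^ (n + 1))⁻¹) * g r) ‖y‖ := by
    rw [← lintegral_indicator measurableSet_ball]
    refine lintegral_congr fun y => ?_
    by_cases hy : y ∈ ball (0 : MTE n) 1
    · have hy' : ‖y‖ ∈ Iio (1:ℝ) := by simpa using hy
      rw [indicator_of_mem hy, indicator_of_mem hy', ← h.dist _ (h.maps y hy), h.inv y hy]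
    · have hy' : ‖y‖ ∉ Iio (1:ℝ) := by simpa using hy
      rw [indicator_of_notMem hy, indicator_of_notMem hy']
  rw [h1, polar_radial n _ (Measurable.indicator (by fun_prop) measurableSet_Iio), sphere_total]
  congr 1
  have h2 : ∀ r, ENNReal.ofReal (r ^ n) * (Iio (1:ℝ)).indicator
        (fun r => ENNReal.ofReal (((1 - r ^ 2) ^ (n + 1))⁻¹) * g r) r =
      (Iio (1:ℝ)).indicator (fun r => ENNReal.ofReal (r ^ n) *
        (ENNReal.ofReal (((1 - r ^ 2) ^ (n + 1))⁻¹) * g r)) r := by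
    intro r
    by_cases hr : r ∈ Iio (1:ℝ)
    · rw [indicator_of_mem hr, indicator_of_mem hr]
    · rw [indicator_of_notMem hr, indicator_of_notMem hr, mul_zero]
  simp_rw [h2]
  rw [lintegral_indicator measurableSet_Iio, Measure.restrict_restrict measurableSet_Iio,
    inter_comm, Ioi_inter_Iio]
  refine setLIntegral_congr_fun measurableSet_Ioo fun r hr => ?_
  rw [← mul_assoc, ← ENNReal.ofReal_mul (by have := hr.1; positivity)]

/-- Near part of the kernel. -/
noncomputable def k1 (n : ℕ) (R r : ℝ) : ℝ≥0∞ := if r ≤ R then ENNReal.ofReal (kap n r) else 0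
/-- Far part of the kernel. -/
noncomputable def k2 (n : ℕ) (R r : ℝ) : ℝ≥0∞ := if r ≤ R then 0 else ENNReal.ofReal (kap n r)

theorem measurable_k1 (n : ℕ) (R : ℝ) : Measurable (k1 n R) :=
  Measurable.ite measurableSet_Iic (measurable_kap n).ennreal_ofReal measurable_const

theorem measurable_k2 (n : ℕ) (R : ℝ) : Measurable (k2 n R) :=
  Measurable.ite measurableSet_Iic measurable_const (measurable_kap n).ennreal_ofReal

theorem k1_add_k2 (n : ℕ) (R r : ℝ) : ENNReal.ofReal (kap n r) = k1 n R r + k2 n R r := by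
  unfold k1 k2; split_ifs <;> simp

theorem near_int {n : ℕ} (x : MTE n) (hx : x ∈ ball (0 : MTE n) 1) (R : ℝ) (hR0 : 0 < R)
    (hR : R ≤ 1 / 2) :
    ∫⁻ y, k1 n R (dd x y) ∂(mm n) ≤ ENNReal.ofReal (2 * sphereVol (n + 1) * R) := by
  rw [radial_mm x hx _ (measurable_k1 n R)]
  have : ∫⁻ r in Ioo (0:ℝ) 1, ENNReal.ofReal (r ^ n * ((1 - r ^ 2) ^ (n + 1))⁻¹) * k1 n R r ≤
      ∫⁻ r in Ioo (0:ℝ) 1, (Ioc (0:ℝ) R).indicator (fun _ => 2) r := by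
    refine setLIntegral_mono' measurableSet_Ioo fun r hr => ?_
    unfold k1
    split_ifs with h
    · rw [indicator_of_mem (show r ∈ Ioc (0:ℝ) R from ⟨hr.1, h⟩)]
      have hr0 := hr.1
      have h1 : 1 / 2 ≤ 1 - r ^ 2 := by nlinarith
      have h2 : 0 < 1 - r ^ 2 := by linarith
      rw [← ENNReal.ofReal_mul (by positivity), kap]
      have : r ^ n * ((1 - r ^ 2) ^ (n + 1))⁻¹ * ((1 - r ^ 2) / r) ^ n = 1 / (1 - r ^ 2) := by
        rw [div_pow, pow_succ]; field_simp
      rw [this]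
      rw [show (2 : ℝ≥0∞) = ENNReal.ofReal 2 by simp]
      apply ENNReal.ofReal_le_ofReal
      rw [div_le_iff₀ h2]; linarith
    · simp
  calc _ ≤ (∫⁻ r, (Ioc (0:ℝ) R).indicator (fun _ => 2) r) *
        ENNReal.ofReal (sphereVol (n + 1)) := by
        exact mul_le_mul_left (this.trans (setLIntegral_le_lintegral _ _)) _
    _ = _ := by
        rw [lintegral_indicator measurableSet_Ioc, setLIntegral_const, Real.volume_Ioc]
        rw [show (2 : ℝ≥0∞) = ENNReal.ofReal 2 by simp, ← ENNReal.ofReal_mul (by norm_num),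
          ← ENNReal.ofReal_mul (by linarith)]
        congr 1; ring

theorem dd_nonneg {n : ℕ} (x y : MTE n) : 0 ≤ dd x y := Real.sqrt_nonneg _

theorem dd_lt_one {n : ℕ} {x y : MTE n} (hx : x ∈ ball (0 : MTE n) 1)
    (hy : y ∈ ball (0 : MTE n) 1) : dd x y < 1 := by
  obtain ⟨T, J, h⟩ := exists_mob x hx
  rw [← h.dist y hy]
  simpa using h.maps y hy

theorem k2_le {n : ℕ} {R r : ℝ} (hR : 0 < R) (hr : r < 1) :
    k2 n R r ≤ ENNReal.ofReal ((R ^ n)⁻¹) := by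
  unfold k2
  split_ifs with h
  · simp
  · push Not at h
    apply ENNReal.ofReal_le_ofReal
    rw [kap, ← inv_pow]
    have hr0 : 0 < r := hR.trans h
    have h0 : 0 ≤ 1 - r ^ 2 := by nlinarith
    gcongr
    rw [inv_eq_one_div]
    gcongr
    nlinarith

theorem k2_rpow {n : ℕ} (hn : 1 ≤ n) {R r : ℝ} (hR : 0 < R) (h : R < r) (hr : r < 1) :
    k2 n R r ^ (1 + 1 / (n : ℝ)) = ENNReal.ofReal (((1 - r ^ 2) / r) ^ (n + 1)) := by
  have hr0 : 0 < r := hR.trans h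
  have h0 : 0 ≤ 1 - r ^ 2 := by nlinarith
  have hn0 : (n : ℝ) ≠ 0 := by positivity
  unfold k2
  rw [if_neg (not_le.2 h), ENNReal.ofReal_rpow_of_nonneg (by unfold kap; positivity) (by positivity)]
  congr 1
  have hb : 0 ≤ (1 - r ^ 2) / r := by positivity
  rw [kap]
  generalize (1 - r ^ 2) / r = b at hb
  rw [← Real.rpow_natCast, ← Real.rpow_mul hb, ← Real.rpow_natCast]
  have : (n : ℝ) * (1 + 1 / (n : ℝ)) = ((n + 1 : ℕ) : ℝ) := by
    push_cast; field_simp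
  rw [this]

theorem far_int {n : ℕ} (hn : 1 ≤ n) (x : MTE n) (hx : x ∈ ball (0 : MTE n) 1) (R R' : ℝ)
    (hR0 : 0 < R) (hR : R ≤ R') (hR' : R' ≤ 1) (Ω : Set (MTE n))
    (hV : R' = 1 ∨ mm n Ω ≤ ENNReal.ofReal (R' ^ (n + 1))) :
    ∫⁻ y in Ω, k2 n R (dd x y) ^ (1 + 1 / (n : ℝ)) ∂(mm n) ≤
      ENNReal.ofReal (sphereVol (n + 1) * Real.log (R' / R) + 1) := by
  have hR'0 : 0 < R' := hR0.trans_le hR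
  set q := 1 + 1 / (n : ℝ) with hq
  have hq0 : 0 < q := by positivity
  set g : ℝ → ℝ≥0∞ := fun r => if r ≤ R' then k2 n R r ^ q else 0 with hg
  have hgm : Measurable g :=
    Measurable.ite measurableSet_Iic ((measurable_k2 n R).pow_const q) measurable_const
  set H : MTE n → ℝ≥0∞ := fun y => if dd x y ≤ R' then 0 else k2 n R (dd x y) ^ q with hH
  have hsplit : ∀ y, k2 n R (dd x y) ^ q = g (dd x y) + H y := by
    intro y; simp only [hg, hH]; split_ifs <;> simp
  have hcomp : Measurable (fun y : MTE n => g (dd x y)) := hgm.comp (measurable_dd_right x)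
  simp_rw [hsplit]
  rw [lintegral_add_left hcomp]
  have hlog : 0 ≤ Real.log (R' / R) := Real.log_nonneg (by rw [le_div_iff₀ hR0]; linarith)
  have hs := (sphereVol_pos n).le
  rw [ENNReal.ofReal_add (by positivity) (by norm_num)]
  refine add_le_add ?_ ?_
  · refine (setLIntegral_le_lintegral _ _).trans ?_
    rw [radial_mm x hx _ hgm, mul_comm (sphereVol _), ENNReal.ofReal_mul hlog]
    gcongr
    have : ∫⁻ r in Ioo (0:ℝ) 1, ENNReal.ofReal (r ^ n * ((1 - r ^ 2) ^ (n + 1))⁻¹) * g r ≤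
        ∫⁻ r in Ioo (0:ℝ) 1, (Ioc R R').indicator (fun r => ENNReal.ofReal (r⁻¹)) r := by
      refine setLIntegral_mono' measurableSet_Ioo fun r hr => ?_
      by_cases h1 : r ∈ Ioc R R'
      · rw [indicator_of_mem h1]
        simp only [hg]
        rw [if_pos h1.2, k2_rpow hn hR0 h1.1 hr.2]
        have hr0 := hr.1
        have h2 : 0 < 1 - r ^ 2 := by nlinarith [hr.2]
        rw [← ENNReal.ofReal_mul (by positivity)]
        apply ENNReal.ofReal_le_ofReal
        apply le_of_eq
        rw [div_pow, pow_succ r]; field_simp; ring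
      · rw [indicator_of_notMem h1]
        simp only [hg]
        by_cases h2 : r ≤ R'
        · have h3 : r ≤ R := by
            by_contra h3; push Not at h3; exact h1 ⟨h3, h2⟩
          simp [h2, k2, h3, hq0]
        · simp [h2]
    refine (this.trans (setLIntegral_le_lintegral _ _)).trans ?_
    rw [lintegral_indicator measurableSet_Ioc, ← ofReal_integral_eq_lintegral_ofReal,
      ← intervalIntegral.integral_of_le hR, integral_inv_of_pos hR0 hR'0]
    · have : IntervalIntegrable (fun r : ℝ => r⁻¹) volume R R' := by
        apply intervalIntegral.intervalIntegrable_inv (f := fun r => r)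
        · intro r hr
          rw [uIcc_of_le hR] at hr
          have := hr.1
          exact (hR0.trans_le this).ne'
        · fun_prop
      exact this.1
    · filter_upwards [ae_restrict_mem measurableSet_Ioc] with r hr
      have : 0 < r := hR0.trans hr.1
      simp only [Pi.zero_apply]; positivity
  · rcases hV with hV | hV
    · subst hV
      have : ∫⁻ y in Ω, H y ∂(mm n) = 0 := by
        rw [lintegral_congr_ae (g := fun _ => 0)]
        · simp
        · refine ae_restrict_of_ae ?_
          filter_upwards [ae_mem_ball n] with y hy
          simp [hH, (dd_lt_one hx hy).le]
      rw [this]; simp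
    · have : ∫⁻ y in Ω, H y ∂(mm n) ≤ ∫⁻ y in Ω, ENNReal.ofReal ((R' ^ (n + 1))⁻¹) ∂(mm n) := by
        refine lintegral_mono_ae (ae_restrict_of_ae ?_)
        filter_upwards [ae_mem_ball n] with y hy
        simp only [hH]
        have h1 := dd_lt_one hx hy
        split_ifs with h
        · simp
        · push Not at h
          rw [k2_rpow hn hR0 (hR.trans_lt h) h1]
          apply ENNReal.ofReal_le_ofReal
          have h0 : 0 ≤ 1 - dd x y ^ 2 := by nlinarith [dd_nonneg x y]
          have h2 : 0 < dd x y := hR'0.trans h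
          rw [← inv_pow]
          gcongr
          rw [inv_eq_one_div]
          gcongr
          nlinarith
      refine this.trans ?_
      rw [setLIntegral_const]
      calc _ ≤ ENNReal.ofReal ((R' ^ (n + 1))⁻¹) * ENNReal.ofReal (R' ^ (n + 1)) := by gcongr
        _ = _ := by
          rw [← ENNReal.ofReal_mul (by positivity), inv_mul_cancel₀ (by positivity)]

end MT

namespace MT

theorem add_rpow_ineq (a b : ℝ≥0∞) {p : ℝ} (hp0 : 0 < p) (hp1 : p ≤ 1) :
    (a + b) ^ (1 + p) ≤ b ^ (1 + p) + a ^ (1 + p) + 2 * (a * b ^ p) := by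
  have e : ∀ c : ℝ≥0∞, c ^ (1 + p) = c * c ^ p := fun c => by
    rw [ENNReal.rpow_add_of_nonneg _ _ zero_le_one hp0.le, ENNReal.rpow_one]
  have h1 : (a + b) ^ p ≤ a ^ p + b ^ p := ENNReal.rpow_add_le_add_rpow a b hp0.le hp1
  have h2 : (a + b) ^ p * b ≤ b ^ p * (a + b) := by
    rcases eq_or_ne b 0 with rfl | hb
    · simp
    rcases eq_or_ne b ∞ with rfl | hb'
    · simp [hp0]
    rcases eq_or_ne a ∞ with rfl | ha'
    · have : b ^ p ≠ 0 := by simp [hb, hb']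
      simp [ENNReal.mul_top this]
    have hab : a + b ≠ 0 := by simp [hb]
    have hab' : a + b ≠ ∞ := by simp [hb', ha']
    have e1 : (a + b) = (a + b) ^ p * (a + b) ^ (1 - p) := by
      rw [← ENNReal.rpow_add _ _ hab hab']; simp
    have e2 : b = b ^ p * b ^ (1 - p) := by
      rw [← ENNReal.rpow_add _ _ hb hb']; simp
    calc (a + b) ^ p * b = (a + b) ^ p * (b ^ p * b ^ (1 - p)) := by rw [← e2]
      _ ≤ (a + b) ^ p * (b ^ p * (a + b) ^ (1 - p)) := by
          gcongr
          exact le_add_self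
      _ = b ^ p * ((a + b) ^ p * (a + b) ^ (1 - p)) := by ring
      _ = _ := by rw [← e1]
  rw [e, e, e]
  calc (a + b) * (a + b) ^ p = a * (a + b) ^ p + (a + b) ^ p * b := by ring
    _ ≤ a * (a ^ p + b ^ p) + b ^ p * (a + b) := by gcongr
    _ = _ := by ring

theorem measurable_dd_left {n : ℕ} (y : MTE n) : Measurable (fun x : MTE n => dd x y) := by
  unfold dd br
  fun_prop

theorem measurable_dd_swap {n : ℕ} : Measurable (fun q : MTE n × MTE n => dd q.2 q.1) := by
  unfold dd br
  fun_prop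

set_option maxHeartbeats 1000000 in
theorem cap_kernel {n : ℕ} (hn : 1 ≤ n) (A Ω : Set (MTE n))
    {b W : ℝ} (hb : 0 < b) (hbW : b ≤ W) (hW : W ≤ 1)
    (hmA : mm n A = ENNReal.ofReal (b ^ (n + 1)))
    (hV : W = 1 ∨ mm n Ω ≤ ENNReal.ofReal (W ^ (n + 1))) :
    ∫⁻ y in Ω, (∫⁻ x in A, ENNReal.ofReal (kap n (dd x y)) ∂(mm n)) ^ (1 + 1 / (n : ℝ)) ∂(mm n) ≤
      ENNReal.ofReal (b ^ (n + 1) * b ^ (1 + 1 / (n : ℝ)) * (sphereVol (n + 1) * Real.log (W / b) +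
        (sphereVol (n + 1) * Real.log 2 + 1 + sphereVol (n + 1) ^ (1 + 1 / (n : ℝ)) +
          4 * sphereVol (n + 1)))) := by
  have hσ : 0 < sphereVol (n + 1) := sphereVol_pos n
  set σ := sphereVol (n + 1) with hσd
  have hnR : (0 : ℝ) < n := by exact_mod_cast hn
  set p : ℝ := 1 / (n : ℝ) with hp
  have hp0 : 0 < p := by positivity
  have hp1 : p ≤ 1 := by
    rw [hp, div_le_one hnR]; exact_mod_cast hn
  have hb1 : b ≤ 1 := hbW.trans hW
  have hR0 : 0 < b / 2 := by positivity
  set m := mm n with hm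
  set a : ℝ≥0∞ := ENNReal.ofReal (b ^ (n + 1)) with ha
  have hk1 : Measurable (fun z : MTE n × MTE n => k1 n (b / 2) (dd z.1 z.2)) :=
    (measurable_k1 n (b / 2)).comp measurable_dd
  have hk2 : Measurable (fun z : MTE n × MTE n => k2 n (b / 2) (dd z.1 z.2)) :=
    (measurable_k2 n (b / 2)).comp measurable_dd
  have hk1' (y : MTE n) : Measurable (fun x : MTE n => k1 n (b / 2) (dd x y)) :=
    (measurable_k1 n (b / 2)).comp (measurable_dd_left y)
  have hk2' (y : MTE n) : Measurable (fun x : MTE n => k2 n (b / 2) (dd x y)) :=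
    (measurable_k2 n (b / 2)).comp (measurable_dd_left y)
  set K1 : MTE n → ℝ≥0∞ := fun y => ∫⁻ x in A, k1 n (b / 2) (dd x y) ∂m with hK1
  set K2 : MTE n → ℝ≥0∞ := fun y => ∫⁻ x in A, k2 n (b / 2) (dd x y) ∂m with hK2
  have mK1 : Measurable K1 := hk1.lintegral_prod_left'
  have mK2 : Measurable K2 := hk2.lintegral_prod_left'
  have hK : ∀ y, ∫⁻ x in A, ENNReal.ofReal (kap n (dd x y)) ∂m = K1 y + K2 y := by
    intro y
    simp only [hK1, hK2, k1_add_k2 n (b / 2)]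
    rw [lintegral_add_left (hk1' y)]
  have e : ∀ c : ℝ≥0∞, c ^ (1 + p) = c * c ^ p := fun c => by
    rw [ENNReal.rpow_add_of_nonneg _ _ zero_le_one hp0.le, ENNReal.rpow_one]
  -- sup K1
  have supK1 : ∀ᵐ y ∂m, K1 y ≤ ENNReal.ofReal (σ * b) := by
    filter_upwards [ae_mem_ball n] with y hy
    calc K1 y ≤ ∫⁻ x, k1 n (b / 2) (dd y x) ∂m := by
          simp only [hK1, dd_comm _ y]
          exact setLIntegral_le_lintegral _ _
      _ ≤ _ := near_int y hy (b / 2) hR0 (by linarith)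
      _ = _ := by rw [← hσd]; congr 1; ring
  have intK1 : ∫⁻ y, K1 y ∂m ≤ ENNReal.ofReal (σ * b) * a := by
    simp only [hK1]
    have hk1s : Measurable (fun z : MTE n × MTE n => k1 n (b / 2) (dd z.2 z.1)) :=
      (measurable_k1 n (b / 2)).comp measurable_dd_swap
    rw [lintegral_lintegral_swap hk1s.aemeasurable]
    calc _ ≤ ∫⁻ x in A, ENNReal.ofReal (σ * b) ∂m := by
          refine lintegral_mono_ae (ae_restrict_of_ae ?_)
          filter_upwards [ae_mem_ball n] with y hy
          refine (near_int y hy (b / 2) hR0 (by linarith)).trans (le_of_eq ?_)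
          rw [← hσd]; congr 1; ring
      _ = _ := by rw [setLIntegral_const, hmA]
  have supK2 : ∀ᵐ y ∂m, K2 y ≤ ENNReal.ofReal ((((b / 2) ^ n)⁻¹)) * a := by
    filter_upwards [ae_mem_ball n] with y hy
    calc K2 y ≤ ∫⁻ x in A, ENNReal.ofReal ((((b / 2) ^ n)⁻¹)) ∂m := by
          refine lintegral_mono_ae (ae_restrict_of_ae ?_)
          filter_upwards [ae_mem_ball n] with x hx
          exact k2_le hR0 (dd_lt_one hx hy)
      _ = _ := by rw [setLIntegral_const, hmA]
  have holder : ∀ y, K2 y ^ (1 + p) ≤ a ^ p * ∫⁻ x in A, k2 n (b / 2) (dd x y) ^ (1 + p) ∂m := by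
    intro y
    have hpq : (1 + p).HolderConjugate (n + 1 : ℝ) := by
      rw [Real.holderConjugate_iff]
      refine ⟨by linarith, ?_⟩
      rw [hp]; field_simp
    have := ENNReal.lintegral_mul_le_Lp_mul_Lq (m.restrict A) hpq (hk2' y).aemeasurable
      (measurable_const (a := (1 : ℝ≥0∞))).aemeasurable
    simp only [Pi.mul_apply, mul_one, ENNReal.one_rpow, lintegral_one, Measure.restrict_apply_univ,
      hmA] at this
    calc K2 y ^ (1 + p) ≤ ((∫⁻ x in A, k2 n (b / 2) (dd x y) ^ (1 + p) ∂m) ^ (1 / (1 + p)) *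
          a ^ (1 / (n + 1 : ℝ))) ^ (1 + p) := by
          gcongr
      _ = _ := by
          rw [ENNReal.mul_rpow_of_nonneg _ _ (by linarith), ← ENNReal.rpow_mul, ← ENNReal.rpow_mul,
            mul_comm]
          have e1 : 1 / (1 + p) * (1 + p) = 1 := by field_simp
          have e2 : 1 / (n + 1 : ℝ) * (1 + p) = p := by rw [hp]; field_simp
          rw [e1, e2, ENNReal.rpow_one]
  have intK2 : ∫⁻ y in Ω, K2 y ^ (1 + p) ∂m ≤
      a ^ p * (a * ENNReal.ofReal (σ * Real.log (W / (b / 2)) + 1)) := by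
    have hk2q : Measurable (fun z : MTE n × MTE n => k2 n (b / 2) (dd z.2 z.1) ^ (1 + p)) :=
      ((measurable_k2 n (b / 2)).comp measurable_dd_swap).pow_const _
    calc _ ≤ ∫⁻ y in Ω, a ^ p * ∫⁻ x in A, k2 n (b / 2) (dd x y) ^ (1 + p) ∂m ∂m :=
          lintegral_mono holder
      _ = a ^ p * ∫⁻ y in Ω, ∫⁻ x in A, k2 n (b / 2) (dd x y) ^ (1 + p) ∂m ∂m := by
          rw [lintegral_const_mul']
          exact ENNReal.rpow_ne_top_of_nonneg hp0.le ENNReal.ofReal_ne_top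
      _ = a ^ p * ∫⁻ x in A, ∫⁻ y in Ω, k2 n (b / 2) (dd x y) ^ (1 + p) ∂m ∂m := by
          rw [lintegral_lintegral_swap hk2q.aemeasurable]
      _ ≤ a ^ p * ∫⁻ x in A, ENNReal.ofReal (σ * Real.log (W / (b / 2)) + 1) ∂m := by
          gcongr _ * ?_
          refine lintegral_mono_ae (ae_restrict_of_ae ?_)
          filter_upwards [ae_mem_ball n] with x hx
          exact far_int hn x hx (b / 2) W hR0 (by linarith) hW Ω hV
      _ = _ := by rw [setLIntegral_const, hmA, mul_comm a]
  have int1 : ∫⁻ y in Ω, K1 y ^ (1 + p) ∂m ≤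
      ENNReal.ofReal (σ * b) ^ p * (ENNReal.ofReal (σ * b) * a) := by
    calc _ ≤ ∫⁻ y in Ω, ENNReal.ofReal (σ * b) ^ p * K1 y ∂m := by
          refine lintegral_mono_ae (ae_restrict_of_ae ?_)
          filter_upwards [supK1] with y hy
          rw [e, mul_comm]
          gcongr
      _ ≤ ∫⁻ y, ENNReal.ofReal (σ * b) ^ p * K1 y ∂m := setLIntegral_le_lintegral _ _
      _ = ENNReal.ofReal (σ * b) ^ p * ∫⁻ y, K1 y ∂m := lintegral_const_mul _ mK1
      _ ≤ _ := by gcongr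
  have int12 : ∫⁻ y in Ω, 2 * (K1 y * K2 y ^ p) ∂m ≤
      2 * ((ENNReal.ofReal ((((b / 2) ^ n)⁻¹)) * a) ^ p * (ENNReal.ofReal (σ * b) * a)) := by
    calc _ ≤ ∫⁻ y, 2 * ((ENNReal.ofReal ((((b / 2) ^ n)⁻¹)) * a) ^ p * K1 y) ∂m := by
          refine (setLIntegral_le_lintegral _ _).trans (lintegral_mono_ae ?_)
          filter_upwards [supK2] with y hy
          rw [mul_comm (K1 y)]
          gcongr
      _ = 2 * ((ENNReal.ofReal ((((b / 2) ^ n)⁻¹)) * a) ^ p * ∫⁻ y, K1 y ∂m) := by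
          rw [lintegral_const_mul _ (mK1.const_mul _), lintegral_const_mul _ mK1]
      _ ≤ _ := by gcongr
  have hlog : 0 ≤ σ * Real.log (W / (b / 2)) + 1 := by
    have : 0 ≤ Real.log (W / (b / 2)) := Real.log_nonneg (by
      rw [le_div_iff₀ hR0]; linarith)
    positivity
  have hap : a ^ p = ENNReal.ofReal (b ^ (1 + p)) := by
    rw [ha, ENNReal.ofReal_rpow_of_nonneg (by positivity) hp0.le, ← Real.rpow_natCast,
      ← Real.rpow_mul hb.le]
    congr 2; push_cast; rw [hp]; field_simp
  calc _ = ∫⁻ y in Ω, (K1 y + K2 y) ^ (1 + p) ∂m := by simp_rw [hK]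
    _ ≤ ∫⁻ y in Ω, (K2 y ^ (1 + p) + K1 y ^ (1 + p) + 2 * (K1 y * K2 y ^ p)) ∂m :=
        lintegral_mono fun y => add_rpow_ineq _ _ hp0 hp1
    _ = ∫⁻ y in Ω, K2 y ^ (1 + p) ∂m + ∫⁻ y in Ω, K1 y ^ (1 + p) ∂m +
          ∫⁻ y in Ω, 2 * (K1 y * K2 y ^ p) ∂m := by
        have h21 : Measurable (fun y => K2 y ^ (1 + p) + K1 y ^ (1 + p)) :=
          (mK2.pow_const _).add (mK1.pow_const _)
        rw [lintegral_add_left h21, lintegral_add_left (mK2.pow_const _)]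
    _ ≤ a ^ p * (a * ENNReal.ofReal (σ * Real.log (W / (b / 2)) + 1)) +
        ENNReal.ofReal (σ * b) ^ p * (ENNReal.ofReal (σ * b) * a) +
        2 * ((ENNReal.ofReal ((((b / 2) ^ n)⁻¹)) * a) ^ p * (ENNReal.ofReal (σ * b) * a)) := by
        gcongr
    _ = _ := by
        rw [hap, ha]
        have e3 : (ENNReal.ofReal (((b / 2) ^ n)⁻¹) * ENNReal.ofReal (b ^ (n + 1))) ^ p =
            ENNReal.ofReal (2 * b ^ p) := by
          rw [← ENNReal.ofReal_mul (by positivity), ENNReal.ofReal_rpow_of_nonneg (by positivity)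
            hp0.le]
          congr 1
          have : ((b / 2) ^ n)⁻¹ * b ^ (n + 1) = 2 ^ n * b := by
            rw [div_pow, pow_succ]; field_simp
          rw [this, Real.mul_rpow (by positivity) hb.le, ← Real.rpow_natCast,
            ← Real.rpow_mul (by norm_num)]
          congr 1
          rw [hp, mul_one_div_cancel hnR.ne', Real.rpow_one]
        rw [e3, ENNReal.ofReal_rpow_of_nonneg (by positivity) hp0.le,
          show (2 : ℝ≥0∞) = ENNReal.ofReal 2 by simp]
        rw [← ENNReal.ofReal_mul (by positivity), ← ENNReal.ofReal_mul (by positivity),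
          ← ENNReal.ofReal_mul (by positivity), ← ENNReal.ofReal_mul (by positivity),
          ← ENNReal.ofReal_mul (by positivity), ← ENNReal.ofReal_mul (by positivity),
          ← ENNReal.ofReal_add (by positivity) (by positivity),
          ← ENNReal.ofReal_add (by positivity) (by positivity)]
        congr 1
        have hW0 : 0 < W := hb.trans_le hbW
        rw [show W / (b / 2) = 2 * (W / b) by field_simp, Real.log_mul (by norm_num) (by positivity),
          Real.mul_rpow hσ.le hb.le, Real.rpow_add hb, Real.rpow_add hσ, Real.rpow_one, Real.rpow_one]
        ring

end MT

namespace MT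

/-- Constant from the kernel estimate. -/
noncomputable def CC (n : ℕ) : ℝ :=
  sphereVol (n + 1) * Real.log 2 + 1 + sphereVol (n + 1) ^ (1 + 1 / (n : ℝ)) +
          4 * sphereVol (n + 1)

/-- Normalised constant. -/
noncomputable def cc (n : ℕ) : ℝ := (n + 1) * CC n / sphereVol (n + 1)

theorem CC_pos (n : ℕ) : 0 < CC n := by
  have := sphereVol_pos n
  have h2 : 0 < Real.log 2 := Real.log_pos (by norm_num)
  unfold CC; positivity

theorem cc_pos (n : ℕ) : 0 < cc n := by
  have := sphereVol_pos n
  have := CC_pos n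
  unfold cc; positivity

theorem alpha_eq (n : ℕ) :
    alphaMT (n + 1) = (n + 1) * sphereVol (n + 1) ^ (1 / (n : ℝ)) := by
  unfold alphaMT; push_cast; congr 3; ring

theorem alpha_pos (n : ℕ) : 0 < alphaMT (n + 1) := by
  have := sphereVol_pos n
  rw [alpha_eq]; positivity

theorem enorm_clm_zero {n : ℕ} : ‖(0 : MTE n →L[ℝ] ℝ)‖ₑ = 0 := by
  rw [← ofReal_norm, norm_zero, ENNReal.ofReal_zero]

theorem energy_mm {n : ℕ} (w : MTE n → ℝ) (hw : ContDiff ℝ 1 w) :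
    ∫⁻ y, (‖fderiv ℝ w y‖ₑ * ENNReal.ofReal (1 - ‖y‖ ^ 2)) ^ ((n : ℝ) + 1) ∂(mm n) ≤
      ∫⁻ y, ‖fderiv ℝ w y‖ₑ ^ (n + 1) := by
  have hc : Continuous (fun y => fderiv ℝ w y) := hw.continuous_fderiv (by norm_num)
  have hm : Measurable (fun y => (‖fderiv ℝ w y‖ₑ * ENNReal.ofReal (1 - ‖y‖ ^ 2)) ^ ((n : ℝ) + 1)) := by
    have h1 : Measurable (fun y => ‖fderiv ℝ w y‖ₑ) := hc.enorm.measurable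
    have h2 : Measurable (fun y : MTE n => ENNReal.ofReal (1 - ‖y‖ ^ 2)) := by fun_prop
    exact (h1.mul h2).pow_const _
  rw [lintegral_mm _ hm]
  refine le_trans (le_of_eq ?_) (setLIntegral_le_lintegral (ball 0 1) _)
  refine setLIntegral_congr_fun measurableSet_ball fun y hy => ?_
  have h0 := norm_sq_lt hy
  have : (n : ℝ) + 1 = ((n + 1 : ℕ) : ℝ) := by push_cast; ring
  simp only [this, ENNReal.rpow_natCast]
  rw [mul_pow, mul_left_comm, ← ENNReal.ofReal_pow h0.le, ← ENNReal.ofReal_mul (by positivity),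
    inv_mul_cancel₀ (by positivity), ENNReal.ofReal_one, mul_one]

theorem capacity {n : ℕ} (hn : 1 ≤ n) (w : MTE n → ℝ) (hw : ContDiff ℝ 1 w)
    (hc : HasCompactSupport w) (hs : tsupport w ⊆ ball 0 1) (A Ω : Set (MTE n))
    (hA : MeasurableSet A) (hΩ : MeasurableSet Ω)
    {b W τ E : ℝ} (hb : 0 < b) (hbW : b ≤ W) (hW : W ≤ 1)
    (hmA : mm n A = ENNReal.ofReal (b ^ (n + 1)))
    (hV : W = 1 ∨ mm n Ω ≤ ENNReal.ofReal (W ^ (n + 1)))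
    (hτ : 0 ≤ τ) (hwA : ∀ x ∈ A, τ ≤ w x) (hwΩ : ∀ x, x ∉ Ω → fderiv ℝ w x = 0)
    (hE0 : 0 ≤ E) (hE : ∫⁻ y, ‖fderiv ℝ w y‖ₑ ^ (n + 1) ≤ ENNReal.ofReal E) :
    alphaMT (n + 1) * τ ^ (1 + 1 / (n : ℝ)) ≤
      E ^ (1 / (n : ℝ)) * ((n + 1) * Real.log (W / b) + cc n) := by
  have hσ : 0 < sphereVol (n + 1) := sphereVol_pos n
  have hnR : (0 : ℝ) < n := by exact_mod_cast hn
  have hcf : Continuous (fun y => fderiv ℝ w y) := hw.continuous_fderiv (by norm_num)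
  have key := cap_kernel hn A Ω hb hbW hW hmA hV
  rw [show sphereVol (n + 1) * Real.log 2 + 1 + sphereVol (n + 1) ^ (1 + 1 / (n : ℝ)) +
          4 * sphereVol (n + 1) = CC n from rfl] at key
  have hlog : 0 ≤ Real.log (W / b) := Real.log_nonneg (by rw [le_div_iff₀ hb]; linarith)
  have hCC := CC_pos n
  set σ := sphereVol (n + 1) with hσd
  set p : ℝ := 1 / (n : ℝ) with hp
  have hp0 : 0 < p := by positivity
  set m := mm n with hm
  set F : MTE n → ℝ≥0∞ := fun y => ‖fderiv ℝ w y‖ₑ * ENNReal.ofReal (1 - ‖y‖ ^ 2) with hF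
  have mF : Measurable F := by
    have h1 : Measurable (fun y => ‖fderiv ℝ w y‖ₑ) := hcf.enorm.measurable
    have h2 : Measurable (fun y : MTE n => ENNReal.ofReal (1 - ‖y‖ ^ 2)) := by fun_prop
    exact h1.mul h2
  set K : MTE n → ℝ≥0∞ := fun y => ∫⁻ x in A, ENNReal.ofReal (kap n (dd x y)) ∂m with hK
  have mk : Measurable (fun z : MTE n × MTE n => ENNReal.ofReal (kap n (dd z.1 z.2))) :=
    ((measurable_kap n).comp measurable_dd).ennreal_ofReal
  have mkl (y : MTE n) : Measurable (fun x : MTE n => ENNReal.ofReal (kap n (dd x y))) :=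
    ((measurable_kap n).comp (measurable_dd_left y)).ennreal_ofReal
  have mK : Measurable K := mk.lintegral_prod_left'
  have mFk : Measurable (fun z : MTE n × MTE n => F z.2 * ENNReal.ofReal (kap n (dd z.1 z.2))) :=
    (mF.comp measurable_snd).mul mk
  have step1 : ENNReal.ofReal (σ * τ * b ^ (n + 1)) ≤ ∫⁻ y in Ω, F y * K y ∂m := by
    calc ENNReal.ofReal (σ * τ * b ^ (n + 1)) = ∫⁻ x in A, ENNReal.ofReal (σ * τ) ∂m := by
          rw [setLIntegral_const, hmA, ENNReal.ofReal_mul (by positivity)]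
      _ ≤ ∫⁻ x in A, ∫⁻ y, F y * ENNReal.ofReal (kap n (dd x y)) ∂m ∂m := by
          refine lintegral_mono_ae ?_
          filter_upwards [ae_restrict_of_ae (ae_mem_ball n), ae_restrict_mem hA] with x hx hxA
          refine le_trans ?_ (representation w hw hc hs x hx)
          rw [ENNReal.ofReal_mul hσ.le]
          gcongr
          rw [Real.enorm_eq_ofReal_abs]
          exact ENNReal.ofReal_le_ofReal ((hwA x hxA).trans (le_abs_self _))
      _ = ∫⁻ y, ∫⁻ x in A, F y * ENNReal.ofReal (kap n (dd x y)) ∂m ∂m := by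
          rw [lintegral_lintegral_swap mFk.aemeasurable]
      _ = ∫⁻ y, F y * K y ∂m := by
          refine lintegral_congr fun y => ?_
          rw [lintegral_const_mul _ (mkl y)]
      _ = _ := by
          rw [← lintegral_indicator hΩ]
          refine lintegral_congr fun y => ?_
          by_cases hy : y ∈ Ω
          · rw [indicator_of_mem hy]
          · rw [indicator_of_notMem hy]
            have : F y = 0 := by simp only [hF]; rw [hwΩ y hy, enorm_clm_zero, zero_mul]
            rw [this, zero_mul]
  have hpq : ((n : ℝ) + 1).HolderConjugate (1 + p) := by
    rw [Real.holderConjugate_iff]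
    refine ⟨by linarith, ?_⟩
    rw [hp]; field_simp
    ring
  have step2 := ENNReal.lintegral_mul_le_Lp_mul_Lq (m.restrict Ω) hpq mF.aemeasurable mK.aemeasurable
  have step3 : ENNReal.ofReal (σ * τ * b ^ (n + 1)) ≤
      ENNReal.ofReal E ^ (1 / ((n : ℝ) + 1)) *
      (ENNReal.ofReal (b ^ (n + 1) * b ^ (1 + p) * (σ * Real.log (W / b) + CC n))) ^ (1 / (1 + p)) := by
    refine step1.trans (step2.trans ?_)
    gcongr
    exact (setLIntegral_le_lintegral _ _).trans ((energy_mm w hw).trans hE)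
  have step4 := ENNReal.rpow_le_rpow step3 (z := 1 + p) (by positivity)
  rw [ENNReal.mul_rpow_of_nonneg _ _ (by positivity), ← ENNReal.rpow_mul, ← ENNReal.rpow_mul,
    show 1 / (1 + p) * (1 + p) = 1 by field_simp, ENNReal.rpow_one,
    show 1 / ((n : ℝ) + 1) * (1 + p) = p by rw [hp]; field_simp,
    ENNReal.ofReal_rpow_of_nonneg (by positivity) (by positivity),
    ENNReal.ofReal_rpow_of_nonneg (by positivity) (by positivity),
    ← ENNReal.ofReal_mul (by positivity),
    ENNReal.ofReal_le_ofReal_iff (by positivity)] at step4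
  rw [Real.mul_rpow (by positivity) (by positivity), Real.mul_rpow hσ.le hτ] at step4
  have hbb : (b ^ (n + 1)) ^ (1 + p) = b ^ (n + 1) * b ^ (1 + p) := by
    rw [Real.rpow_add (by positivity), Real.rpow_one, ← Real.rpow_natCast, ← Real.rpow_mul hb.le]
    congr 2
    push_cast; rw [hp]; field_simp
  rw [hbb] at step4
  have hB : 0 < b ^ (n + 1) * b ^ (1 + p) := by positivity
  have step5 : σ ^ (1 + p) * τ ^ (1 + p) ≤ E ^ p * (σ * Real.log (W / b) + CC n) := by
    refine le_of_mul_le_mul_right ?_ hB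
    calc _ ≤ _ := step4
      _ = _ := by ring
  rw [Real.rpow_add hσ, Real.rpow_one] at step5
  rw [alpha_eq, cc, ← hσd, ← hp]
  refine le_of_mul_le_mul_left ?_ hσ
  have h6 := mul_le_mul_of_nonneg_left step5 (show (0 : ℝ) ≤ n + 1 by positivity)
  calc _ = (n + 1) * (σ * σ ^ p * τ ^ (1 + p)) := by ring
    _ ≤ _ := h6
    _ = _ := by field_simp

theorem exists_trunc {s t ε : ℝ} (hε : 0 < ε) (hst : s + 2 * ε < t) :
    ∃ ψ ψd : ℝ → ℝ, (∀ v, HasDerivAt ψ (ψd v) v) ∧ Continuous ψd ∧ (∀ v, 0 ≤ ψd v) ∧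
      (∀ v, ψd v ≤ 1) ∧ (∀ v, v ∉ Ioo s t → ψd v = 0) ∧ (∀ v ≤ s, ψ v = 0) ∧
      (∀ v, t ≤ v → t - s - 2 * ε ≤ ψ v) := by
  set f : ℝ → ℝ := fun v => max 0 (min 1 (min ((v - s) / ε) ((t - v) / ε))) with hf
  have fc : Continuous f := by fun_prop
  have fint : ∀ a b, IntervalIntegrable f volume a b := fun a b => fc.intervalIntegrable a b
  have f0 : ∀ v, 0 ≤ f v := fun v => le_max_left _ _
  have fz : ∀ v, v ∉ Ioo s t → f v = 0 := by
    intro v hv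
    simp only [hf]
    apply max_eq_left
    rw [mem_Ioo, not_and_or, not_lt, not_lt] at hv
    rcases hv with h | h
    · refine (min_le_right _ _).trans ((min_le_left _ _).trans ?_)
      exact div_nonpos_of_nonpos_of_nonneg (by linarith) hε.le
    · refine (min_le_right _ _).trans ((min_le_right _ _).trans ?_)
      exact div_nonpos_of_nonpos_of_nonneg (by linarith) hε.le
  have f1 : ∀ v, s + ε ≤ v → v ≤ t - ε → 1 ≤ f v := by
    intro v h1 h2
    refine le_max_of_le_right (le_min le_rfl (le_min ?_ ?_))
    · rw [le_div_iff₀ hε]; linarith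
    · rw [le_div_iff₀ hε]; linarith
  refine ⟨fun v => ∫ x in s..v, f x, f, fun v => ?_, fc, f0, ?_, fz, ?_, ?_⟩
  · exact fc.integral_hasStrictDerivAt s v |>.hasDerivAt
  · intro v
    exact max_le zero_le_one (min_le_left _ _)
  · intro v hv
    show ∫ x in s..v, f x = 0
    rw [intervalIntegral.integral_congr (g := fun _ => 0)]
    · simp
    · intro x hx
      rw [uIcc_of_ge hv] at hx
      exact fz x (fun h => absurd h.1 (not_lt.2 hx.2))
  · intro v hv
    show _ ≤ ∫ x in s..v, f x
    rw [← intervalIntegral.integral_add_adjacent_intervals (fint s (s + ε)) (fint (s + ε) v),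
      ← intervalIntegral.integral_add_adjacent_intervals (fint (s + ε) (t - ε)) (fint (t - ε) v)]
    have a1 : 0 ≤ ∫ x in s..(s + ε), f x :=
      intervalIntegral.integral_nonneg (by linarith) fun x _ => f0 x
    have a3 : 0 ≤ ∫ x in (t - ε)..v, f x :=
      intervalIntegral.integral_nonneg (by linarith) fun x _ => f0 x
    have a2 : ∫ x in (s + ε)..(t - ε), (1 : ℝ) ≤ ∫ x in (s + ε)..(t - ε), f x := by
      refine intervalIntegral.integral_mono_on (by linarith) (by simp) (fint _ _) fun x hx => ?_
      exact f1 x hx.1 hx.2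
    rw [intervalIntegral.integral_const, smul_eq_mul, mul_one] at a2
    linarith

theorem capacity_trunc {n : ℕ} (hn : 1 ≤ n) (u : MTE n → ℝ) (hu : ContDiff ℝ 1 u)
    (hc : HasCompactSupport u) (hs : tsupport u ⊆ ball 0 1)
    {b W s t E : ℝ} (hb : 0 < b) (hbW : b ≤ W) (hW : W ≤ 1) (hs0 : 0 ≤ s) (hst : s ≤ t)
    (hmA : mm n {x | t < u x} = ENNReal.ofReal (b ^ (n + 1)))
    (hV : W = 1 ∨ mm n {x | s < u x} ≤ ENNReal.ofReal (W ^ (n + 1)))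
    (hE0 : 0 ≤ E)
    (hE : ∫⁻ y in {x | u x ∈ Ioo s t}, ‖fderiv ℝ u y‖ₑ ^ (n + 1) ≤ ENNReal.ofReal E) :
    alphaMT (n + 1) * (t - s) ^ (1 + 1 / (n : ℝ)) ≤
      E ^ (1 / (n : ℝ)) * ((n + 1) * Real.log (W / b) + cc n) := by
  have hlog : 0 ≤ Real.log (W / b) := Real.log_nonneg (by rw [le_div_iff₀ hb]; linarith)
  have hccp := cc_pos n
  rcases hst.eq_or_lt with rfl | hst
  · rw [sub_self, Real.zero_rpow (by positivity), mul_zero]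
    positivity
  have main : ∀ ε > 0, s + 2 * ε < t → alphaMT (n + 1) * (t - s - 2 * ε) ^ (1 + 1 / (n : ℝ)) ≤
      E ^ (1 / (n : ℝ)) * ((n + 1) * Real.log (W / b) + cc n) := by
    intro ε hε hεst
    obtain ⟨ψ, ψd, hψ, hψc, h0, h1, hz, hl, ht⟩ := exists_trunc hε hεst
    have hd : deriv ψ = ψd := funext fun v => (hψ v).deriv
    have hψ1 : ContDiff ℝ 1 ψ := by
      rw [contDiff_one_iff_deriv]
      exact ⟨fun v => (hψ v).differentiableAt, by rw [hd]; exact hψc⟩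
    have hψ0 : ψ 0 = 0 := hl 0 hs0
    have hfd : ∀ x, fderiv ℝ (fun x => ψ (u x)) x = ψd (u x) • fderiv ℝ u x := by
      intro x
      have hux : HasFDerivAt u (fderiv ℝ u x) x :=
        (hu.differentiable (by norm_num) x).hasFDerivAt
      exact ((hψ (u x)).comp_hasFDerivAt x hux).fderiv
    refine capacity hn (fun x => ψ (u x)) (hψ1.comp hu) (hc.comp_left hψ0)
      ((tsupport_comp_subset hψ0 u).trans hs) {x | t < u x} {x | s < u x}
      (measurableSet_lt measurable_const hu.continuous.measurable)
      (measurableSet_lt measurable_const hu.continuous.measurable) hb hbW hW hmA hV (by linarith)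
      (fun x hx => ht _ (le_of_lt hx)) ?_ hE0 ?_
    · intro x hx
      rw [hfd, hz, zero_smul]
      exact fun h => hx h.1
    · refine le_trans ?_ hE
      have hmeas : MeasurableSet {x | u x ∈ Ioo s t} := hu.continuous.measurable measurableSet_Ioo
      rw [← lintegral_indicator hmeas]
      refine lintegral_mono fun x => ?_
      by_cases hx : u x ∈ Ioo s t
      · rw [indicator_of_mem (show x ∈ {x | u x ∈ Ioo s t} from hx)]
        simp only [hfd]
        gcongr
        rw [enorm_smul]
        calc _ ≤ 1 * ‖fderiv ℝ u x‖ₑ := by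
              gcongr
              rw [Real.enorm_eq_ofReal (h0 _)]
              simpa using h1 (u x)
          _ = _ := one_mul _
      · rw [hfd, hz _ hx, zero_smul, enorm_clm_zero]
        simp
  have hcont : Filter.Tendsto (fun ε : ℝ => alphaMT (n + 1) * (t - s - 2 * ε) ^ (1 + 1 / (n : ℝ)))
      (nhdsWithin 0 (Ioi 0)) (nhds (alphaMT (n + 1) * (t - s - 2 * 0) ^ (1 + 1 / (n : ℝ)))) := by
    refine Filter.Tendsto.mono_left (Continuous.tendsto ?_ 0) nhdsWithin_le_nhds
    refine continuous_const.mul ?_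
    exact Continuous.rpow_const (by fun_prop) fun x => Or.inr (by positivity)
  rw [mul_zero, sub_zero] at hcont
  refine le_of_tendsto hcont ?_
  have : Ioo 0 ((t - s) / 2) ∈ nhdsWithin (0 : ℝ) (Ioi 0) := Ioo_mem_nhdsGT (by linarith)
  filter_upwards [this] with ε hε
  exact main ε hε.1 (by have := hε.2; linarith)

end MT

namespace MT

theorem young_nat {n : ℕ} (hn : 1 ≤ n) {X Y : ℝ} (hX : 0 ≤ X) (hY : 0 ≤ Y) :
    (n + 1) * (X ^ n * Y) ≤ n * X ^ (n + 1) + Y ^ (n + 1) := by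
  have hnR : (0 : ℝ) < n := by exact_mod_cast hn
  have hpq : (1 + 1 / (n : ℝ)).HolderConjugate ((n : ℝ) + 1) := by
    rw [Real.holderConjugate_iff]
    refine ⟨by have : 0 < 1 / (n : ℝ) := by positivity
               linarith, ?_⟩
    field_simp
  have h := Real.young_inequality_of_nonneg (pow_nonneg hX n) hY hpq
  have e1 : (X ^ n) ^ (1 + 1 / (n : ℝ)) = X ^ (n + 1) := by
    rw [← Real.rpow_natCast, ← Real.rpow_mul hX, ← Real.rpow_natCast]
    congr 1; push_cast; field_simp
  have e2 : Y ^ ((n : ℝ) + 1) = Y ^ (n + 1) := by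
    rw [← Real.rpow_natCast]; congr 1; push_cast; ring
  rw [e1, e2] at h
  have h2 := mul_le_mul_of_nonneg_left h (show (0 : ℝ) ≤ n + 1 by positivity)
  refine h2.trans (le_of_eq ?_)
  field_simp

theorem deriv_abs_pow {n : ℕ} (hn : 1 ≤ n) (x : ℝ) :
    ∃ D, HasDerivAt (fun x : ℝ => |x| ^ (n + 1)) D x ∧ |D| ≤ (n + 1) * |x| ^ n := by
  have hnR : (1 : ℝ) ≤ n := by exact_mod_cast hn
  have h := hasDerivAt_abs_rpow x (p := (n : ℝ) + 1) (by linarith)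
  refine ⟨((n : ℝ) + 1) * |x| ^ ((n : ℝ) + 1 - 2) * x, ?_, ?_⟩
  · convert h using 2 with y
    rw [← Real.rpow_natCast]; congr 1; push_cast; ring
  · rw [abs_mul, abs_mul, abs_of_nonneg (show (0 : ℝ) ≤ n + 1 by positivity),
      abs_of_nonneg (Real.rpow_nonneg (abs_nonneg x) _), mul_assoc]
    gcongr
    rcases eq_or_ne x 0 with rfl | hx
    · simp
    · have hx' : 0 < |x| := abs_pos.2 hx
      rw [← Real.rpow_add_one hx'.ne', ← Real.rpow_natCast]
      apply le_of_eq; congr 1; ring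

theorem ray_poincare {n : ℕ} (hn : 1 ≤ n) (f f' : ℝ → ℝ) (hf : ∀ r, HasDerivAt f (f' r) r)
    (hf' : Continuous f') {R : ℝ} (hR0 : 0 < R) (hR1 : R < 1) (hfR : f R = 0) :
    ∫⁻ r in Ioc 0 R, ENNReal.ofReal (r ^ n * (|f r| / (1 - r ^ 2)) ^ (n + 1)) ≤
      ∫⁻ r in Ioc 0 R, ENNReal.ofReal (r ^ n * |f' r| ^ (n + 1)) := by
  have hfc : Continuous f := continuous_iff_continuousAt.2 fun r => (hf r).continuousAt
  have hne : ∀ r ∈ Icc 0 R, 0 < 1 - r ^ 2 := fun r hr => by nlinarith [hr.1, hr.2]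
  have hc1 : ContinuousOn (fun r => r ^ n * (|f r| / (1 - r ^ 2)) ^ (n + 1)) (Icc 0 R) := by
    refine ContinuousOn.mul (by fun_prop) (ContinuousOn.pow ?_ _)
    exact ContinuousOn.div (by fun_prop) (by fun_prop) fun r hr => (hne r hr).ne'
  have hc2 : ContinuousOn (fun r => r ^ n * |f' r| ^ (n + 1)) (Icc 0 R) := by fun_prop
  have i1 := hc1.integrableOn_Icc (μ := volume)
  have i2 := hc2.integrableOn_Icc (μ := volume)
  choose D hD hDle using deriv_abs_pow hn
  have key := intervalIntegral.integral_le_sub_of_hasDeriv_right_of_le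
    (g := fun r => r ^ (n + 1) * (((1 - r ^ 2) ^ n)⁻¹ * |f r| ^ (n + 1)))
    (g' := fun r => (n + 1) * r ^ n * (((1 - r ^ 2) ^ n)⁻¹ * |f r| ^ (n + 1)) +
      r ^ (n + 1) * ((-(n * (1 - r ^ 2) ^ (n - 1) * (-(2 * r))) / ((1 - r ^ 2) ^ n) ^ 2) * |f r| ^ (n + 1) +
        ((1 - r ^ 2) ^ n)⁻¹ * (D (f r) * f' r)))
    (φ := fun r => r ^ n * (|f r| / (1 - r ^ 2)) ^ (n + 1) - r ^ n * |f' r| ^ (n + 1))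
    hR0.le ?_ ?_ (i1.sub i2) ?_
  · simp only [hfR, abs_zero, ne_eq, Nat.add_eq_zero_iff, one_ne_zero, and_false,
      not_false_eq_true, zero_pow, mul_zero, zero_mul, sub_zero] at key
    rw [intervalIntegral.integral_sub (by rwa [intervalIntegrable_iff_integrableOn_Icc_of_le hR0.le])
      (by rwa [intervalIntegrable_iff_integrableOn_Icc_of_le hR0.le]), sub_nonpos,
      intervalIntegral.integral_of_le hR0.le, intervalIntegral.integral_of_le hR0.le] at key
    rw [← ofReal_integral_eq_lintegral_ofReal (i1.mono_set Ioc_subset_Icc_self),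
      ← ofReal_integral_eq_lintegral_ofReal (i2.mono_set Ioc_subset_Icc_self)]
    · exact ENNReal.ofReal_le_ofReal key
    · filter_upwards [ae_restrict_mem measurableSet_Ioc] with r hr
      have := hr.1
      simp only [Pi.zero_apply]; positivity
    · filter_upwards [ae_restrict_mem measurableSet_Ioc] with r hr
      have := hr.1
      have := hne r ⟨hr.1.le, hr.2⟩
      simp only [Pi.zero_apply]; positivity
  · refine ContinuousOn.mul (by fun_prop) (ContinuousOn.mul ?_ (by fun_prop))
    exact ContinuousOn.inv₀ (by fun_prop) fun r hr => (pow_pos (hne r hr) n).ne'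
  · intro r hr
    have h0 := hne r ⟨hr.1.le, hr.2.le⟩
    refine HasDerivAt.hasDerivWithinAt ?_
    refine HasDerivAt.mul ?_ (HasDerivAt.mul ?_ ?_)
    · simpa using hasDerivAt_pow (n + 1) r
    · have h1 : HasDerivAt (fun r : ℝ => 1 - r ^ 2) (-(2 * r)) r := by
        simpa using (hasDerivAt_pow 2 r).const_sub 1
      exact (h1.pow n).inv (pow_pos h0 n).ne'
    · exact (hD (f r)).comp r (hf r)
  · intro r hr
    have h0 := hne r ⟨hr.1.le, hr.2.le⟩
    have hr0 := hr.1
    have hr1 : r < 1 := hr.2.trans hR1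
    obtain ⟨k, rfl⟩ : ∃ k, n = k + 1 := ⟨n - 1, by omega⟩
    have hy := young_nat hn (X := |f r| / (1 - r ^ 2)) (by positivity) (abs_nonneg (f' r))
    have hDr : -((((k + 1 : ℕ) : ℝ) + 1) * |f r| ^ (k + 1) * |f' r|) ≤ D (f r) * f' r := by
      have := hDle (f r)
      calc _ ≤ -(|D (f r)| * |f' r|) := by gcongr
        _ = -|D (f r) * f' r| := by rw [abs_mul]
        _ ≤ _ := neg_abs_le _
    set v := 1 - r ^ 2 with hv
    set F := |f r| with hF
    have hF0 : 0 ≤ F := abs_nonneg _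
    set Y := |f' r| with hY
    have hY0 : 0 ≤ Y := abs_nonneg _
    set X := F / v with hX
    have hX0 : 0 ≤ X := by positivity
    have eF : F = X * v := by rw [hX]; field_simp
    have e1 : (v ^ (k + 1))⁻¹ * F ^ (k + 1 + 1) = X ^ (k + 1 + 1) * v := by
      rw [eF, mul_pow, pow_succ v (k + 1)]; field_simp
    have e2 : -(((k + 1 : ℕ) : ℝ) * v ^ (k + 1 - 1) * -(2 * r)) / (v ^ (k + 1)) ^ 2 * F ^ (k + 1 + 1)
        = ((k + 1 : ℕ) : ℝ) * (2 * r) * X ^ (k + 1 + 1) := by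
      rw [eF, mul_pow, Nat.add_sub_cancel]; field_simp
      ring
    have e3 : -(((k + 1 : ℕ) : ℝ) + 1) * (X ^ (k + 1) * Y) ≤
        (v ^ (k + 1))⁻¹ * (D (f r) * f' r) := by
      calc _ = (v ^ (k + 1))⁻¹ * -((((k + 1 : ℕ) : ℝ) + 1) * F ^ (k + 1) * Y) := by
            rw [eF, mul_pow]; field_simp
        _ ≤ _ := by gcongr
    rw [e1, e2]
    have hrk : 0 ≤ r ^ (k + 1) := by positivity
    have hXN : 0 ≤ X ^ (k + 1 + 1) := by positivity
    have hA : 0 ≤ X ^ (k + 1) * Y := by positivity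
    have hk1 : (1 : ℝ) ≤ ((k + 1 : ℕ) : ℝ) := by push_cast; linarith [Nat.cast_nonneg (α := ℝ) k]
    set m : ℝ := ((k + 1 : ℕ) : ℝ) with hm
    set P := X ^ (k + 1 + 1) with hP
    set Q := X ^ (k + 1) * Y with hQ
    set G := (v ^ (k + 1))⁻¹ * (D (f r) * f' r)
    set Z := Y ^ (k + 1 + 1)
    have : P - Z ≤ (m + 1) * (P * v) + r * (m * (2 * r) * P + G) := by
      have : r * (-(m + 1) * Q) ≤ r * G := mul_le_mul_of_nonneg_left e3 hr0.le
      have h5 : -(m + 1) * Q ≤ r * (-(m + 1) * Q) := by nlinarith [mul_nonneg (by linarith : (0:ℝ) ≤ m + 1) hA]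
      have h6 : 0 ≤ (m - 1) * r ^ 2 * P := by
        have : 0 ≤ m - 1 := by linarith
        positivity
      nlinarith
    calc _ = r ^ (k + 1) * (P - Z) := by ring
      _ ≤ r ^ (k + 1) * _ := mul_le_mul_of_nonneg_left this hrk
      _ = _ := by rw [pow_succ r (k + 1)]; ring

theorem exists_R {n : ℕ} (u : MTE n → ℝ) (hs : tsupport u ⊆ ball 0 1) :
    ∃ R, 0 < R ∧ R < 1 ∧ ∀ z, R ≤ ‖z‖ → u z = 0 := by
  obtain ⟨R, hR, hsub⟩ := exists_lt_subset_ball (isClosed_tsupport u) hs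
  refine ⟨max R (1 / 2), by positivity, max_lt hR (by norm_num), fun z hz => ?_⟩
  by_contra h
  have := hsub (subset_tsupport u h)
  simp only [mem_ball, dist_zero_right] at this
  linarith [le_max_left R (1 / 2)]

theorem poincare {n : ℕ} (hn : 1 ≤ n) (u : MTE n → ℝ) (hu : ContDiff ℝ 1 u)
    (hs : tsupport u ⊆ ball 0 1) :
    ∫⁻ y, ‖u y‖ₑ ^ (n + 1) ∂(mm n) ≤ ∫⁻ y, ‖fderiv ℝ u y‖ₑ ^ (n + 1) := by
  have hcf : Continuous (fun y => fderiv ℝ u y) := hu.continuous_fderiv (by norm_num)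
  have huc := hu.continuous
  obtain ⟨R, hR0, hR1, hR⟩ := exists_R u hs
  have m1 : Measurable (fun y => ‖u y‖ₑ ^ (n + 1)) := huc.measurable.enorm.pow_const _
  have m2 : Measurable (fun y => ‖fderiv ℝ u y‖ₑ ^ (n + 1)) := hcf.enorm.measurable.pow_const _
  have m3 : Measurable ((ball (0 : MTE n) 1).indicator
      (fun y => ENNReal.ofReal (((1 - ‖y‖ ^ 2) ^ (n + 1))⁻¹) * ‖u y‖ₑ ^ (n + 1))) := by
    refine Measurable.indicator ?_ measurableSet_ball
    exact Measurable.mul (by fun_prop) m1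
  rw [lintegral_mm _ m1, ← lintegral_indicator measurableSet_ball, polar n _ m3, polar n _ m2]
  refine lintegral_mono fun θ => ?_
  have hθ : ‖(θ : MTE n)‖ = 1 := by simp
  have hray : ∀ r, HasDerivAt (fun r : ℝ => u (r • (θ : MTE n)))
      (fderiv ℝ u (r • (θ : MTE n)) (θ : MTE n)) r := by
    intro r
    have h1 : HasDerivAt (fun r : ℝ => r • (θ : MTE n)) (θ : MTE n) r := by
      simpa using (hasDerivAt_id r).smul_const (θ : MTE n)
    exact ((hu.differentiable (by norm_num) _).hasFDerivAt).comp_hasDerivAt r h1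
  have hcont : Continuous fun r : ℝ => fderiv ℝ u (r • (θ : MTE n)) (θ : MTE n) := by
    have : Continuous fun r : ℝ => fderiv ℝ u (r • (θ : MTE n)) :=
      hcf.comp (continuous_id.smul continuous_const)
    exact this.clm_apply continuous_const
  have hrp := ray_poincare hn _ _ hray hcont hR0 hR1 (hR _ (by
    rw [norm_smul, hθ, mul_one, Real.norm_eq_abs]; exact le_abs_self R))
  calc _ ≤ ∫⁻ r in Ioi (0:ℝ), (Ioc 0 R).indicator (fun r => ENNReal.ofReal
          (r ^ n * (|u (r • (θ : MTE n))| / (1 - r ^ 2)) ^ (n + 1))) r := by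
        refine setLIntegral_mono' measurableSet_Ioi fun r hr => ?_
        have hr0 : (0:ℝ) < r := hr
        have hnr : ‖r • (θ : MTE n)‖ = r := by rw [norm_smul, hθ, mul_one, Real.norm_of_nonneg hr0.le]
        by_cases h : r ≤ R
        · have hv : 0 < 1 - r ^ 2 := by nlinarith
          rw [indicator_of_mem (show r ∈ Ioc 0 R from ⟨hr0, h⟩), indicator_of_mem (by
            rw [mem_ball, dist_zero_right, hnr]; linarith), hnr, Real.enorm_eq_ofReal_abs,
            ← ENNReal.ofReal_pow (abs_nonneg _), ← ENNReal.ofReal_mul (by positivity),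
            ← ENNReal.ofReal_mul (by positivity)]
          apply le_of_eq; congr 2
          rw [div_pow]; field_simp
        · have : u (r • (θ : MTE n)) = 0 := hR _ (by rw [hnr]; linarith)
          have hz : ∀ S : Set (MTE n), S.indicator (fun y => ENNReal.ofReal
              (((1 - ‖y‖ ^ 2) ^ (n + 1))⁻¹) * ‖u y‖ₑ ^ (n + 1)) (r • (θ : MTE n)) = 0 := by
            intro S
            refine indicator_apply_eq_zero.2 fun _ => ?_
            simp [this]
          rw [hz, mul_zero]
          exact zero_le
    _ = ∫⁻ r in Ioc 0 R, ENNReal.ofReal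
          (r ^ n * (|u (r • (θ : MTE n))| / (1 - r ^ 2)) ^ (n + 1)) := by
        rw [lintegral_indicator measurableSet_Ioc, Measure.restrict_restrict measurableSet_Ioc,
          inter_eq_left.2 Ioc_subset_Ioi_self]
    _ ≤ _ := hrp
    _ ≤ ∫⁻ r in Ioi (0:ℝ), ENNReal.ofReal
          (r ^ n * |fderiv ℝ u (r • (θ : MTE n)) (θ : MTE n)| ^ (n + 1)) :=
        lintegral_mono_set Ioc_subset_Ioi_self
    _ ≤ _ := by
        refine setLIntegral_mono' measurableSet_Ioi fun r hr => ?_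
        have hr0 : (0:ℝ) < r := hr
        rw [ENNReal.ofReal_mul (by positivity), ← ofReal_norm, ← ENNReal.ofReal_pow (norm_nonneg _)]
        gcongr
        have := (fderiv ℝ u (r • (θ : MTE n))).le_opNorm (θ : MTE n)
        rwa [hθ, mul_one] at this

end MT

namespace MT

/-- Constant in the Garsia type argument. -/
noncomputable def C0 (n : ℕ) : ℝ := (1 + 1 / (n : ℝ)) ^ (n + 1) * n * 2 ^ n

theorem C0_ge {n : ℕ} (hn : 1 ≤ n) : 1 ≤ C0 n := by
  have hnR : (1 : ℝ) ≤ n := by exact_mod_cast hn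
  have h1 : (1 : ℝ) ≤ (1 + 1 / (n : ℝ)) ^ (n + 1) := one_le_pow₀ (by
    have : 0 ≤ 1 / (n : ℝ) := by positivity
    linarith)
  have h2 : (1 : ℝ) ≤ 2 ^ n := one_le_pow₀ (by norm_num)
  unfold C0
  calc (1 : ℝ) = 1 * 1 * 1 := by norm_num
    _ ≤ _ := by gcongr

theorem garsia {n : ℕ} (hn : 1 ≤ n) {α c s t e Ms Mt l : ℝ} (hα : 0 < α) (hc : 0 < c)
    (hs : 0 < s) (hst : s ≤ t) (he0 : 0 ≤ e) (he1 : e ≤ 1) (hMs : 0 ≤ Ms) (hl : 0 ≤ l)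
    (h1 : α * s ^ (1 + 1 / (n : ℝ)) ≤ e ^ (1 / (n : ℝ)) * (Ms + c))
    (h2 : α * (t - s) ^ (1 + 1 / (n : ℝ)) ≤ (1 - e) ^ (1 / (n : ℝ)) * (Mt - Ms + c))
    (h3 : Ms ≤ α * s ^ (1 + 1 / (n : ℝ)) + l) (h4 : Mt ≤ α * t ^ (1 + 1 / (n : ℝ)) + l)
    (h5 : 2 * C0 n * (l + c) ≤ α * s ^ (1 + 1 / (n : ℝ))) :
    α * t ^ (1 + 1 / (n : ℝ)) - α * s ^ (1 + 1 / (n : ℝ)) ≤ 2 * C0 n * (l + c) := by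
  have hnR : (1 : ℝ) ≤ n := by exact_mod_cast hn
  have hn0 : (0 : ℝ) < n := by linarith
  have hC0 := C0_ge hn
  set p : ℝ := 1 / (n : ℝ) with hp
  have hp0 : 0 < p := by positivity
  have hpn : ∀ z : ℝ, 0 ≤ z → (z ^ p) ^ n = z := by
    intro z hz
    rw [← Real.rpow_natCast, ← Real.rpow_mul hz, hp, one_div_mul_cancel hn0.ne', Real.rpow_one]
  have ht : 0 < t := hs.trans_le hst
  set x := α * s ^ (1 + p) with hx
  set y := α * t ^ (1 + p) with hy
  have hx0 : 0 < x := by positivity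
  have hxy : x ≤ y := by
    rw [hx, hy]; gcongr
  set L := l + c with hL
  have hL0 : 0 < L := by linarith
  have hep1 : e ^ p ≤ 1 := Real.rpow_le_one he0 he1 hp0.le
  have hep0 : 0 ≤ e ^ p := by positivity
  -- lower bound for Ms
  have hMs' : x - c ≤ Ms := by
    have : e ^ p * (Ms + c) ≤ 1 * (Ms + c) := mul_le_mul_of_nonneg_right hep1 (by linarith)
    linarith
  -- bound for 1 - e
  have hx1 : x ≤ e ^ p * (x + L) := 
    h1.trans (mul_le_mul_of_nonneg_left (by linarith) hep0)
  have hx2 : x ^ n ≤ e * (x + L) ^ n := by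
    calc x ^ n ≤ (e ^ p * (x + L)) ^ n := by gcongr
      _ = _ := by rw [mul_pow, hpn e he0]
  have hbern : 1 - n * (L / (x + L)) ≤ (x / (x + L)) ^ n := by
    have := one_add_mul_le_pow (a := -(L / (x + L))) (by
      have : L / (x + L) ≤ 1 := by rw [div_le_one (by linarith)]; linarith
      linarith) n
    calc _ = 1 + n * -(L / (x + L)) := by ring
      _ ≤ _ := this
      _ = _ := by congr 1; field_simp; ring
  have h1e : 1 - e ≤ n * L / x := by
    have : (x / (x + L)) ^ n ≤ e := by
      rw [div_pow, div_le_iff₀ (by positivity)]; exact hx2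
    have h7 : n * (L / (x + L)) ≤ n * L / x := by
      rw [mul_div_assoc]; gcongr; linarith
    linarith
  set D := y - x with hD
  have hD0 : 0 ≤ D := by linarith
  have h6 : α * (t - s) ^ (1 + p) ≤ (n * L / x) ^ p * (D + 2 * L) := by
    refine h2.trans ?_
    have h61 : (1 - e) ^ p ≤ (n * L / x) ^ p := by
      apply Real.rpow_le_rpow (by linarith) h1e hp0.le
    have h62 : Mt - Ms + c ≤ D + 2 * L := by rw [hD, hL]; linarith
    calc (1 - e) ^ p * (Mt - Ms + c) ≤ (1 - e) ^ p * (D + 2 * L) := by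
          exact mul_le_mul_of_nonneg_left h62 (Real.rpow_nonneg (by linarith) _)
      _ ≤ _ := by gcongr
  have hts : 0 ≤ t - s := by linarith
  have h7 : α ^ n * (t - s) ^ (n + 1) ≤ (n * L / x) * (D + 2 * L) ^ n := by
    have := pow_le_pow_left₀ (by positivity) h6 n
    rw [mul_pow, mul_pow, hpn _ (by positivity), ← Real.rpow_natCast ((t - s) ^ (1 + p)),
      ← Real.rpow_mul hts] at this
    have e1 : (t - s) ^ ((1 + p) * n) = (t - s) ^ (n + 1) := by
      rw [← Real.rpow_natCast]; congr 1; push_cast; rw [hp]; field_simp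
    rwa [e1] at this
  have h8 : D ≤ α * (1 + p) * t ^ p * (t - s) := by
    have hb := one_add_mul_self_le_rpow_one_add (s := s / t - 1) (by
      have : 0 ≤ s / t := by positivity
      linarith) (p := 1 + p) (by linarith)
    rw [show 1 + (s / t - 1) = s / t by ring, Real.div_rpow hs.le ht.le,
      le_div_iff₀ (by positivity)] at hb
    have e1 : t ^ (1 + p) = t * t ^ p := by rw [Real.rpow_add ht, Real.rpow_one]
    rw [hD, hx, hy]
    have : t ^ (1 + p) - s ^ (1 + p) ≤ (1 + p) * t ^ p * (t - s) := by
      calc _ ≤ t ^ (1 + p) - (1 + (1 + p) * (s / t - 1)) * t ^ (1 + p) := by linarith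
        _ = _ := by rw [e1]; field_simp; ring
    calc _ = α * (t ^ (1 + p) - s ^ (1 + p)) := by ring
      _ ≤ α * _ := mul_le_mul_of_nonneg_left this hα.le
      _ = _ := by ring
  have htp : (t ^ p) ^ (n + 1) = t ^ (1 + p) := by
    rw [pow_succ, hpn t ht.le, Real.rpow_add ht, Real.rpow_one]
  have h9 : D ^ (n + 1) ≤ (1 + p) ^ (n + 1) * y * ((n * L / x) * (D + 2 * L) ^ n) := by
    calc D ^ (n + 1) ≤ (α * (1 + p) * t ^ p * (t - s)) ^ (n + 1) := by gcongr
      _ = (1 + p) ^ (n + 1) * (α * (t ^ p) ^ (n + 1)) * (α ^ n * (t - s) ^ (n + 1)) := by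
          rw [mul_pow, mul_pow, mul_pow, pow_succ α n]; ring
      _ = (1 + p) ^ (n + 1) * y * (α ^ n * (t - s) ^ (n + 1)) := by rw [htp]
      _ ≤ _ := by gcongr
  by_contra hcon
  push Not at hcon
  have hDpos : 0 < D := lt_trans (by positivity) hcon
  have h2L : 2 * L ≤ D := by
    have : 2 * L * 1 ≤ 2 * L * C0 n := mul_le_mul_of_nonneg_left hC0 (by positivity)
    linarith
  have h10 : D ^ (n + 1) ≤ (1 + p) ^ (n + 1) * y * ((n * L / x) * (2 * D) ^ n) := by
    refine h9.trans ?_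
    gcongr
    linarith
  have h11 : D * x ≤ C0 n * L * (x + D) := by
    have hDn : 0 < D ^ n := by positivity
    refine le_of_mul_le_mul_right ?_ hDn
    calc D * x * D ^ n = D ^ (n + 1) * x := by ring
      _ ≤ (1 + p) ^ (n + 1) * y * ((n * L / x) * (2 * D) ^ n) * x := by gcongr
      _ = _ := by
        rw [show y = x + D by rw [hD]; ring, C0, ← hp, mul_pow]; field_simp
  have h12 : C0 n * L * x < D * x / 2 := by
    have : C0 n * L < D / 2 := by linarith
    calc _ < D / 2 * x := mul_lt_mul_of_pos_right this hx0
      _ = _ := by ring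
  have h13 : C0 n * L * D ≤ x * D / 2 := by
    have : C0 n * L ≤ x / 2 := by linarith
    calc _ ≤ x / 2 * D := mul_le_mul_of_nonneg_right this hD0
      _ = _ := by ring
  have h14 : C0 n * L * (x + D) = C0 n * L * x + C0 n * L * D := by ring
  have h15 : x * D = D * x := mul_comm _ _
  linarith

theorem garsia_sum (A c : ℝ) (hA : 0 ≤ A) (hc : 0 ≤ c) :
    ∃ B : ℝ, 0 ≤ B ∧ ∀ (T : Finset ℕ) (F : ℕ → ℝ), (∀ k ∈ T, -c ≤ F k) →
      (∀ m : ℕ, ∀ k ∈ T, ∀ j ∈ T, k ≤ j → F k ≤ m → F j ≤ m → A * (m + c) ≤ k →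
        (j : ℝ) - k ≤ A * (m + c)) → ∑ k ∈ T, Real.exp (-F k) ≤ B := by
  have hsum : Summable (fun m : ℕ => (2 * (A * (m + c)) + 2) * Real.exp (-m)) := by
    have s1 : Summable (fun m : ℕ => (m : ℝ) ^ 1 * Real.exp (-1 * m)) := by
      have := Real.summable_pow_mul_exp_neg_nat_mul 1 (r := 1) one_pos
      simpa using this
    have s0 : Summable (fun m : ℕ => (m : ℝ) ^ 0 * Real.exp (-1 * m)) := by
      have := Real.summable_pow_mul_exp_neg_nat_mul 0 (r := 1) one_pos
      simpa using this
    refine ((s1.mul_left (2 * A)).add (s0.mul_left (2 * A * c + 2))).congr fun m => ?_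
    simp only [pow_one, pow_zero, one_mul, neg_mul]; ring
  refine ⟨Real.exp (c + 1) * ∑' m : ℕ, (2 * (A * (m + c)) + 2) * Real.exp (-m), ?_, ?_⟩
  · refine mul_nonneg (Real.exp_pos _).le (tsum_nonneg fun m => by positivity)
  intro T F hF hT
  have h1 : ∀ k ∈ T, Real.exp (-F k) ≤ Real.exp (c + 1) * Real.exp (-(⌈F k⌉₊ : ℝ)) := by
    intro k hk
    rw [← Real.exp_add]
    apply Real.exp_le_exp.2
    rcases le_or_gt (F k) 0 with h | h
    · rw [Nat.ceil_eq_zero.2 h]; have := hF k hk; simp; linarith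
    · have := Nat.ceil_lt_add_one h.le; linarith
  have hcard : ∀ m : ℕ, ((T.filter fun k => ⌈F k⌉₊ = m).card : ℝ) ≤ 2 * (A * (m + c)) + 2 := by
    intro m
    set S := T.filter fun k => ⌈F k⌉₊ = m with hS
    have hSF : ∀ k ∈ S, k ∈ T ∧ F k ≤ m := by
      intro k hk
      rw [hS, Finset.mem_filter] at hk
      exact ⟨hk.1, by rw [← hk.2]; exact Nat.le_ceil _⟩
    set Q := A * (m + c) with hQ
    have hQ0 : 0 ≤ Q := by positivity
    have hlow : S.filter (fun k : ℕ => (k : ℝ) < Q) ⊆ Finset.range ⌈Q⌉₊ := by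
      intro k hk
      rw [Finset.mem_filter] at hk
      rw [Finset.mem_range]
      exact Nat.lt_ceil.2 hk.2
    have hc1 : ((S.filter (fun k : ℕ => (k : ℝ) < Q)).card : ℝ) ≤ Q + 1 := by
      have := Finset.card_le_card hlow
      rw [Finset.card_range] at this
      calc _ ≤ ((⌈Q⌉₊ : ℕ) : ℝ) := by exact_mod_cast this
        _ ≤ _ := (Nat.ceil_lt_add_one hQ0).le
    have hc2 : ((S.filter (fun k : ℕ => ¬ (k : ℝ) < Q)).card : ℝ) ≤ Q + 1 := by
      rcases (S.filter (fun k : ℕ => ¬ (k : ℝ) < Q)).eq_empty_or_nonempty with h | h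
      · rw [h]; simp; linarith
      · set k1 := (S.filter (fun k : ℕ => ¬ (k : ℝ) < Q)).min' h with hk1
        have hk1m := Finset.min'_mem _ h
        rw [← hk1, Finset.mem_filter] at hk1m
        have hsub : S.filter (fun k : ℕ => ¬ (k : ℝ) < Q) ⊆ Finset.Icc k1 (k1 + ⌊Q⌋₊) := by
          intro j hj
          have hle : k1 ≤ j := Finset.min'_le _ _ hj
          rw [Finset.mem_filter] at hj
          rw [Finset.mem_Icc]
          refine ⟨hle, ?_⟩
          have := hT m k1 (hSF _ hk1m.1).1 j (hSF _ hj.1).1 hle (hSF _ hk1m.1).2 (hSF _ hj.1).2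
            (not_lt.1 hk1m.2)
          have h2 : ((j - k1 : ℕ) : ℝ) ≤ Q := by rw [Nat.cast_sub hle]; exact this
          have := Nat.le_floor h2
          omega
        have := Finset.card_le_card hsub
        rw [Nat.card_Icc, show k1 + ⌊Q⌋₊ + 1 - k1 = ⌊Q⌋₊ + 1 by omega] at this
        calc _ ≤ ((⌊Q⌋₊ + 1 : ℕ) : ℝ) := by exact_mod_cast this
          _ ≤ _ := by push_cast; linarith [Nat.floor_le hQ0]
    have := Finset.card_filter_add_card_filter_not (s := S) (fun k : ℕ => (k : ℝ) < Q)
    have h3 : (S.card : ℝ) = (S.filter (fun k : ℕ => (k : ℝ) < Q)).card +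
        (S.filter (fun k : ℕ => ¬ (k : ℝ) < Q)).card := by exact_mod_cast this.symm
    linarith
  calc ∑ k ∈ T, Real.exp (-F k) ≤ ∑ k ∈ T, Real.exp (c + 1) * Real.exp (-(⌈F k⌉₊ : ℝ)) :=
        Finset.sum_le_sum h1
    _ = Real.exp (c + 1) * ∑ k ∈ T, Real.exp (-(⌈F k⌉₊ : ℝ)) := by rw [Finset.mul_sum]
    _ = Real.exp (c + 1) * ∑ m ∈ T.image (fun k => ⌈F k⌉₊),
          ((T.filter fun k => ⌈F k⌉₊ = m).card : ℝ) * Real.exp (-m) := by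
        rw [Finset.sum_comp (fun m : ℕ => Real.exp (-(m : ℝ))) (fun k => ⌈F k⌉₊)]
        simp
    _ ≤ Real.exp (c + 1) * ∑ m ∈ T.image (fun k => ⌈F k⌉₊),
          (2 * (A * (m + c)) + 2) * Real.exp (-m) := by
        gcongr with m hm
        exact hcard m
    _ ≤ _ := by
        gcongr
        exact hsum.sum_le_tsum _ fun m _ => by positivity

end MT

namespace MT

/-- Energy below level `s`. -/
noncomputable def ee {n : ℕ} (u : MTE n → ℝ) (s : ℝ) : ℝ :=
  (∫⁻ y in {x | u x ∈ Ioo 0 s}, ‖fderiv ℝ u y‖ₑ ^ (n + 1)).toReal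

theorem root_pow {n : ℕ} {a : ℝ} (ha : 0 ≤ a) : (a ^ (1 / ((n : ℝ) + 1))) ^ (n + 1) = a := by
  rw [← Real.rpow_natCast, ← Real.rpow_mul ha]
  push_cast
  rw [one_div_mul_cancel (by positivity), Real.rpow_one]

theorem ee_ofReal {n : ℕ} (u : MTE n → ℝ) (s : ℝ)
    (hE : ∫⁻ y, ‖fderiv ℝ u y‖ₑ ^ (n + 1) ≤ 1) :
    ∫⁻ y in {x | u x ∈ Ioo 0 s}, ‖fderiv ℝ u y‖ₑ ^ (n + 1) = ENNReal.ofReal (ee u s) := by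
  rw [ee, ENNReal.ofReal_toReal]
  exact ne_top_of_le_ne_top ENNReal.one_ne_top ((setLIntegral_le_lintegral _ _).trans hE)

theorem ee_le_one {n : ℕ} (u : MTE n → ℝ) (s : ℝ)
    (hE : ∫⁻ y, ‖fderiv ℝ u y‖ₑ ^ (n + 1) ≤ 1) : ee u s ≤ 1 := by
  unfold ee
  exact ENNReal.toReal_le_of_le_ofReal zero_le_one
    (by rw [ENNReal.ofReal_one]; exact (setLIntegral_le_lintegral _ _).trans hE)

theorem estF1 {n : ℕ} (hn : 1 ≤ n) (u : MTE n → ℝ) (hu : ContDiff ℝ 1 u)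
    (hc : HasCompactSupport u) (hs : tsupport u ⊆ ball 0 1)
    (hE : ∫⁻ y, ‖fderiv ℝ u y‖ₑ ^ (n + 1) ≤ 1) {s a : ℝ} (hs0 : 0 ≤ s) (ha0 : 0 < a) (ha1 : a ≤ 1)
    (ha : mm n {x | s < u x} = ENNReal.ofReal a) :
    alphaMT (n + 1) * s ^ (1 + 1 / (n : ℝ)) ≤
      ee u s ^ (1 / (n : ℝ)) * (-Real.log a + cc n) := by
  have hb : 0 < a ^ (1 / ((n : ℝ) + 1)) := by positivity
  have hb1 : a ^ (1 / ((n : ℝ) + 1)) ≤ 1 := Real.rpow_le_one ha0.le ha1 (by positivity)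
  have := capacity_trunc hn u hu hc hs hb hb1 le_rfl le_rfl hs0 (by rw [root_pow ha0.le]; exact ha)
    (Or.inl rfl) ENNReal.toReal_nonneg (ee_ofReal u s hE).le
  rw [sub_zero] at this
  refine this.trans (le_of_eq ?_)
  congr 2
  rw [one_div (a ^ _), Real.log_inv, Real.log_rpow ha0]
  field_simp

theorem estF2 {n : ℕ} (hn : 1 ≤ n) (u : MTE n → ℝ) (hu : ContDiff ℝ 1 u)
    (hc : HasCompactSupport u) (hs : tsupport u ⊆ ball 0 1)
    (hE : ∫⁻ y, ‖fderiv ℝ u y‖ₑ ^ (n + 1) ≤ 1) {s t a a' : ℝ} (hs0 : 0 ≤ s) (hst : s ≤ t)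
    (ha1 : a ≤ 1)
    (ha0' : 0 < a')
    (ha : mm n {x | s < u x} = ENNReal.ofReal a) (ha' : mm n {x | t < u x} = ENNReal.ofReal a') :
    alphaMT (n + 1) * (t - s) ^ (1 + 1 / (n : ℝ)) ≤
      (1 - ee u s) ^ (1 / (n : ℝ)) * (-Real.log a' - -Real.log a + cc n) := by
  have haa : a' ≤ a := by
    have : mm n {x | t < u x} ≤ mm n {x | s < u x} :=
      measure_mono fun x (hx : t < u x) => lt_of_le_of_lt hst hx
    rw [ha, ha'] at this
    by_contra h
    push Not at h
    exact absurd this (not_le.2 ((ENNReal.ofReal_lt_ofReal_iff ha0').2 h))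
  have ha0 : 0 < a := ha0'.trans_le haa
  have hb : 0 < a' ^ (1 / ((n : ℝ) + 1)) := by positivity
  have hbW : a' ^ (1 / ((n : ℝ) + 1)) ≤ a ^ (1 / ((n : ℝ) + 1)) := by gcongr
  have hb1 : a ^ (1 / ((n : ℝ) + 1)) ≤ 1 := Real.rpow_le_one ha0.le ha1 (by positivity)
  have hm : MeasurableSet {x | u x ∈ Ioo s t} := hu.continuous.measurable measurableSet_Ioo
  have hdisj : Disjoint {x | u x ∈ Ioo 0 s} {x | u x ∈ Ioo s t} := by
    rw [Set.disjoint_left]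
    intro x h1 h2
    exact lt_asymm h1.2 h2.1
  have hen : ∫⁻ y in {x | u x ∈ Ioo s t}, ‖fderiv ℝ u y‖ₑ ^ (n + 1) ≤
      ENNReal.ofReal (1 - ee u s) := by
    have h1 : ENNReal.ofReal (ee u s) +
        ∫⁻ y in {x | u x ∈ Ioo s t}, ‖fderiv ℝ u y‖ₑ ^ (n + 1) ≤ 1 := by
      rw [← ee_ofReal u s hE, ← lintegral_union hm hdisj]
      exact (setLIntegral_le_lintegral _ _).trans hE
    rw [ENNReal.ofReal_sub _ (show 0 ≤ ee u s from ENNReal.toReal_nonneg), ENNReal.ofReal_one]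
    exact ENNReal.le_sub_of_add_le_left ENNReal.ofReal_ne_top h1
  have := capacity_trunc hn u hu hc hs hb hbW hb1 hs0 hst (by rw [root_pow ha0'.le]; exact ha')
    (Or.inr (by rw [root_pow ha0.le]; exact ha.le)) (by linarith [ee_le_one u s hE]) hen
  refine this.trans (le_of_eq ?_)
  congr 2
  rw [Real.log_div (by positivity) (by positivity), Real.log_rpow ha0, Real.log_rpow ha0']
  field_simp
  ring

/-- Level corresponding to `k`. -/
noncomputable def sl (n : ℕ) (k : ℝ) : ℝ := (k / alphaMT (n + 1)) ^ (1 / (1 + 1 / (n : ℝ)))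

theorem sl_spec (n : ℕ) {k : ℝ} (hk : 0 ≤ k) :
    alphaMT (n + 1) * sl n k ^ (1 + 1 / (n : ℝ)) = k := by
  have hα := alpha_pos n
  unfold sl
  rw [← Real.rpow_mul (by positivity), one_div_mul_cancel (by positivity), Real.rpow_one]
  field_simp

theorem sl_nonneg (n : ℕ) {k : ℝ} (hk : 0 ≤ k) : 0 ≤ sl n k := by
  have hα := alpha_pos n
  unfold sl; positivity

theorem sl_mono (n : ℕ) {k j : ℝ} (hk : 0 ≤ k) (h : k ≤ j) : sl n k ≤ sl n j := by
  have hα := alpha_pos n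
  unfold sl; gcongr

theorem sl_one (n : ℕ) {k : ℝ} (h : alphaMT (n + 1) ≤ k) : 1 ≤ sl n k := by
  have hα := alpha_pos n
  unfold sl
  exact Real.one_le_rpow (by rw [le_div_iff₀ hα]; linarith) (by positivity)

theorem lt_sl_iff (n : ℕ) {k v : ℝ} (hk : 0 ≤ k) (hv : 0 ≤ v) :
    sl n k < v ↔ k < alphaMT (n + 1) * v ^ (1 + 1 / (n : ℝ)) := by
  have hα := alpha_pos n
  have hs := sl_nonneg n hk
  conv_rhs => lhs; rw [← sl_spec n hk]
  rw [mul_lt_mul_iff_right₀ hα, Real.rpow_lt_rpow_iff hs hv (by positivity)]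

theorem mass_le_one {n : ℕ} (hn : 1 ≤ n) (u : MTE n → ℝ) (hu : ContDiff ℝ 1 u)
    (hs : tsupport u ⊆ ball 0 1)
    (hE : ∫⁻ y, ‖fderiv ℝ u y‖ₑ ^ (n + 1) ≤ 1) {s : ℝ} (hs1 : 1 ≤ s) :
    mm n {x | s < u x} ≤ 1 := by
  have m1 : Measurable (fun y => ‖u y‖ₑ ^ (n + 1)) := hu.continuous.measurable.enorm.pow_const _
  have h1 := mul_meas_ge_le_lintegral (μ := mm n) m1 1
  rw [one_mul] at h1
  refine le_trans (measure_mono ?_) (h1.trans ((poincare hn u hu hs).trans hE))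
  intro x hx
  have hx' : s < u x := hx
  show 1 ≤ ‖u x‖ₑ ^ (n + 1)
  apply one_le_pow₀
  rw [Real.enorm_eq_ofReal (by linarith)]
  rw [ENNReal.one_le_ofReal]; linarith

/-- Starting index. -/
noncomputable def k0 (n : ℕ) : ℕ := ⌈alphaMT (n + 1)⌉₊

theorem level_bound {n : ℕ} (hn : 1 ≤ n) : ∃ B : ℝ, 0 ≤ B ∧ ∀ (u : MTE n → ℝ),
    ContDiff ℝ 1 u → HasCompactSupport u → tsupport u ⊆ ball 0 1 →
    ∫⁻ y, ‖fderiv ℝ u y‖ₑ ^ (n + 1) ≤ 1 →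
    ∫⁻ x in {x | sl n (k0 n) < u x},
      ENNReal.ofReal (Real.exp (alphaMT (n + 1) * u x ^ (1 + 1 / (n : ℝ)))) ∂(mm n) ≤
      ENNReal.ofReal B := by
  have hα := alpha_pos n
  have hcc := cc_pos n
  have hC0 := C0_ge hn
  obtain ⟨B, hB0, hB⟩ := garsia_sum (2 * C0 n) (cc n) (by linarith) hcc.le
  refine ⟨Real.exp 1 * B, by positivity, fun u hu hc hs hE => ?_⟩
  set α := alphaMT (n + 1) with hαd
  have huc := hu.continuous
  set q : ℝ := 1 + 1 / (n : ℝ) with hq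
  have hq0 : 0 < q := by positivity
  -- upper bound for u
  obtain ⟨K, hK⟩ : ∃ K : ℕ, ∀ x, sl n (k0 n) < u x → α * u x ^ q ≤ K := by
    obtain ⟨b, hb⟩ := hc.exists_bound_of_continuous huc
    refine ⟨⌈α * b ^ q⌉₊, fun x hx => ?_⟩
    have hux : 0 ≤ u x := (sl_nonneg n (Nat.cast_nonneg _)).trans hx.le
    refine le_trans ?_ (Nat.le_ceil _)
    have := (le_abs_self _).trans (hb x)
    gcongr
  have hk0 : ∀ k : ℕ, k0 n ≤ k → α ≤ k := by
    intro k hk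
    exact (Nat.le_ceil _).trans (by exact_mod_cast hk)
  have hfin : ∀ k : ℕ, k0 n ≤ k → mm n {x | sl n k < u x} ≤ 1 := fun k hk =>
    mass_le_one hn u hu hs hE (sl_one n (hk0 k hk))
  set a : ℕ → ℝ := fun k => (mm n {x | sl n k < u x}).toReal with ha
  have haof : ∀ k : ℕ, k0 n ≤ k → mm n {x | sl n k < u x} = ENNReal.ofReal (a k) := fun k hk => by
    rw [ha, ENNReal.ofReal_toReal (ne_top_of_le_ne_top ENNReal.one_ne_top (hfin k hk))]
  have ha1 : ∀ k : ℕ, k0 n ≤ k → a k ≤ 1 := fun k hk =>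
    ENNReal.toReal_le_of_le_ofReal zero_le_one (by simpa using hfin k hk)
  have ha0 : ∀ k, 0 ≤ a k := fun k => ENNReal.toReal_nonneg
  set T := (Finset.Ico (k0 n) K).filter (fun k => 0 < a k) with hT
  set F : ℕ → ℝ := fun k => -Real.log (a k) - k with hF
  have hTm : ∀ k ∈ T, k0 n ≤ k ∧ 0 < a k := by
    intro k hk
    rw [hT, Finset.mem_filter, Finset.mem_Ico] at hk
    exact ⟨hk.1.1, hk.2⟩
  have hM0 : ∀ k ∈ T, 0 ≤ -Real.log (a k) := by
    intro k hk
    have := Real.log_nonpos (ha0 k) (ha1 k (hTm k hk).1)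
    linarith
  have f1 : ∀ k ∈ T, α * sl n k ^ q ≤ ee u (sl n k) ^ (1 / (n : ℝ)) * (-Real.log (a k) + cc n) := by
    intro k hk
    obtain ⟨h1, h2⟩ := hTm k hk
    exact estF1 hn u hu hc hs hE (sl_nonneg n (Nat.cast_nonneg _)) h2 (ha1 k h1) (haof k h1)
  have hsum := hB T F ?_ ?_
  · have hpt : ∀ x, ({x | sl n (k0 n) < u x}).indicator
        (fun x => ENNReal.ofReal (Real.exp (α * u x ^ q))) x ≤
        ∑ k ∈ Finset.Ico (k0 n) K, ({x | sl n k < u x}).indicator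
          (fun _ => ENNReal.ofReal (Real.exp (k + 1))) x := by
      intro x
      by_cases hx : sl n (k0 n) < u x
      · rw [indicator_of_mem (show x ∈ {x | sl n (k0 n) < u x} from hx)]
        have hux : 0 ≤ u x := (sl_nonneg n (Nat.cast_nonneg _)).trans hx.le
        have h1 := (lt_sl_iff n (Nat.cast_nonneg _) hux).1 hx
        have h2 := hK x hx
        set X := α * u x ^ q with hX
        have hX0 : 0 < X := lt_of_le_of_lt (Nat.cast_nonneg _) h1
        have hceil : 0 < ⌈X⌉₊ := Nat.ceil_pos.2 hX0
        have hc1 := Nat.ceil_lt_add_one hX0.le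
        have hc2 := Nat.le_ceil X
        have hcast : ((⌈X⌉₊ - 1 : ℕ) : ℝ) = (⌈X⌉₊ : ℝ) - 1 := by
          rw [Nat.cast_sub hceil]; simp
        have hkm : ⌈X⌉₊ - 1 ∈ Finset.Ico (k0 n) K := by
          rw [Finset.mem_Ico]
          have h3 : ⌈X⌉₊ ≤ K := Nat.ceil_le.2 h2
          have h4 : k0 n < ⌈X⌉₊ := Nat.lt_ceil.2 h1
          omega
        refine le_trans ?_ (Finset.single_le_sum (f := fun k : ℕ => ({x | sl n k < u x}).indicator
          (fun _ => ENNReal.ofReal (Real.exp (k + 1))) x) (fun _ _ => zero_le) hkm)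
        have hmem : x ∈ {x | sl n ((⌈X⌉₊ - 1 : ℕ) : ℝ) < u x} := by
          show sl n ((⌈X⌉₊ - 1 : ℕ) : ℝ) < u x
          rw [lt_sl_iff n (Nat.cast_nonneg _) hux, hcast]
          linarith
        simp only [indicator_of_mem hmem]
        apply ENNReal.ofReal_le_ofReal
        apply Real.exp_le_exp.2
        rw [hcast]; linarith
      · rw [indicator_of_notMem (show x ∉ {x | sl n (k0 n) < u x} from hx)]
        exact zero_le
    have hmeas : ∀ k : ℕ, MeasurableSet {x | sl n k < u x} := fun k =>
      measurableSet_lt measurable_const huc.measurable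
    rw [← lintegral_indicator (hmeas _)]
    calc _ ≤ ∫⁻ x, ∑ k ∈ Finset.Ico (k0 n) K, ({x | sl n k < u x}).indicator
          (fun _ => ENNReal.ofReal (Real.exp (k + 1))) x ∂(mm n) := lintegral_mono hpt
      _ = ∑ k ∈ Finset.Ico (k0 n) K, ENNReal.ofReal (Real.exp (k + 1)) * mm n {x | sl n k < u x} := by
          rw [lintegral_finsetSum _ fun k _ => measurable_const.indicator (hmeas k)]
          refine Finset.sum_congr rfl fun k _ => ?_
          rw [lintegral_indicator (hmeas k), setLIntegral_const]
      _ = ∑ k ∈ Finset.Ico (k0 n) K, ENNReal.ofReal (Real.exp (k + 1) * a k) := by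
          refine Finset.sum_congr rfl fun k hk => ?_
          rw [haof k (Finset.mem_Ico.1 hk).1, ENNReal.ofReal_mul (by positivity)]
      _ = ENNReal.ofReal (∑ k ∈ Finset.Ico (k0 n) K, Real.exp (k + 1) * a k) := by
          rw [ENNReal.ofReal_sum_of_nonneg]
          intro k _; have := ha0 k; positivity
      _ = ENNReal.ofReal (∑ k ∈ T, Real.exp (k + 1) * a k) := by
          congr 1
          symm
          refine Finset.sum_subset (Finset.filter_subset _ _) fun k hk hk' => ?_
          have : a k = 0 := by
            by_contra h
            exact hk' (Finset.mem_filter.2 ⟨hk, lt_of_le_of_ne (ha0 k) (Ne.symm h)⟩)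
          rw [this, mul_zero]
      _ = ENNReal.ofReal (Real.exp 1 * ∑ k ∈ T, Real.exp (-F k)) := by
          congr 1
          rw [Finset.mul_sum]
          refine Finset.sum_congr rfl fun k hk => ?_
          rw [hF]
          simp only
          rw [show -(-Real.log (a k) - (k : ℝ)) = k + Real.log (a k) by ring, Real.exp_add,
            Real.exp_add, Real.exp_log (hTm k hk).2]
          ring
      _ ≤ _ := by
          apply ENNReal.ofReal_le_ofReal
          gcongr
  · intro k hk
    have h := f1 k hk
    rw [sl_spec n (Nat.cast_nonneg k)] at h
    have h1 : ee u (sl n k) ^ (1 / (n : ℝ)) ≤ 1 :=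
      Real.rpow_le_one ENNReal.toReal_nonneg (ee_le_one u _ hE) (by positivity)
    have h2 := hM0 k hk
    have h3 : ee u (sl n k) ^ (1 / (n : ℝ)) * (-Real.log (a k) + cc n) ≤
      1 * (-Real.log (a k) + cc n) := mul_le_mul_of_nonneg_right h1 (by linarith)
    simp only [hF]; linarith
  · intro m k hk j hj hkj hFk hFj hA
    obtain ⟨h1, h2⟩ := hTm k hk
    obtain ⟨h3, h4⟩ := hTm j hj
    have hsm : sl n k ≤ sl n j := sl_mono n (Nat.cast_nonneg _) (by exact_mod_cast hkj)
    have hslk : 0 < sl n k := lt_of_lt_of_le one_pos (sl_one n (hk0 k h1))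
    have f2 := estF2 hn u hu hc hs hE hslk.le hsm (ha1 k h1) h4 (haof k h1) (haof j h3)
    have := garsia hn hα hcc hslk hsm ENNReal.toReal_nonneg (ee_le_one u _ hE) (hM0 k hk)
      (Nat.cast_nonneg m) (f1 k hk) f2
      (by rw [sl_spec n (Nat.cast_nonneg k)]; simp only [hF] at hFk; linarith)
      (by rw [sl_spec n (Nat.cast_nonneg j)]; simp only [hF] at hFj; linarith)
      (by rw [sl_spec n (Nat.cast_nonneg k)]; exact hA)
    rw [sl_spec n (Nat.cast_nonneg k), sl_spec n (Nat.cast_nonneg j)] at this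
    exact this

end MT

namespace MT

theorem Phi_eq {n : ℕ} (hn : 1 ≤ n) (t : ℝ) :
    PhiMT (n + 1) t = Real.exp (alphaMT (n + 1) * |t| ^ (1 + 1 / (n : ℝ))) -
      ∑ j ∈ Finset.range n, (alphaMT (n + 1) * |t| ^ (1 + 1 / (n : ℝ))) ^ j / (Nat.factorial j : ℝ) := by
  have hn0 : (n : ℝ) ≠ 0 := by positivity
  have h1 : ((n + 1 : ℕ) : ℝ) / (((n + 1 : ℕ) : ℝ) - 1) = 1 + 1 / (n : ℝ) := by
    push_cast
    rw [add_sub_cancel_right]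
    field_simp
  unfold PhiMT
  rw [h1, Nat.add_sub_cancel]
  congr 1
  refine Finset.sum_congr rfl fun j _ => ?_
  rw [mul_pow, ← Real.rpow_natCast (|t| ^ (1 + 1 / (n : ℝ))) j, ← Real.rpow_mul (abs_nonneg t),
    mul_div_assoc (j : ℝ), h1, mul_comm (j : ℝ)]

theorem Phi_nonneg {n : ℕ} (hn : 1 ≤ n) (t : ℝ) : 0 ≤ PhiMT (n + 1) t := by
  rw [Phi_eq hn]
  have hα := alpha_pos n
  have := Real.sum_le_exp_of_nonneg
    (show 0 ≤ alphaMT (n + 1) * |t| ^ (1 + 1 / (n : ℝ)) by positivity) n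
  linarith

theorem Phi_le_exp {n : ℕ} (hn : 1 ≤ n) (t : ℝ) :
    PhiMT (n + 1) t ≤ Real.exp (alphaMT (n + 1) * |t| ^ (1 + 1 / (n : ℝ))) := by
  rw [Phi_eq hn]
  have hα := alpha_pos n
  have : 0 ≤ ∑ j ∈ Finset.range n,
      (alphaMT (n + 1) * |t| ^ (1 + 1 / (n : ℝ))) ^ j / (Nat.factorial j : ℝ) :=
    Finset.sum_nonneg fun j _ => by positivity
  linarith

theorem exp_sub_le {X : ℝ} (hX : 0 ≤ X) (n : ℕ) :
    Real.exp X - ∑ j ∈ Finset.range n, X ^ j / (Nat.factorial j : ℝ) ≤ X ^ n * Real.exp X := by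
  have h := Complex.norm_exp_sub_sum_le_norm_mul_exp (X : ℂ) n
  have h2 : Complex.exp (X : ℂ) - ∑ m ∈ Finset.range n, (X : ℂ) ^ m / (m.factorial : ℂ) =
      ((Real.exp X - ∑ j ∈ Finset.range n, X ^ j / (Nat.factorial j : ℝ) : ℝ) : ℂ) := by
    push_cast; rfl
  rw [h2, Complex.norm_real, Complex.norm_real, Real.norm_of_nonneg hX] at h
  exact (le_abs_self _).trans h

theorem Phi_le_pow {n : ℕ} (hn : 1 ≤ n) {t K : ℝ}
    (ht : alphaMT (n + 1) * |t| ^ (1 + 1 / (n : ℝ)) ≤ K) :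
    PhiMT (n + 1) t ≤ (alphaMT (n + 1) ^ n * Real.exp K) * |t| ^ (n + 1) := by
  have hα := alpha_pos n
  have hn0 : (n : ℝ) ≠ 0 := by positivity
  rw [Phi_eq hn]
  refine (exp_sub_le (by positivity) n).trans ?_
  have h1 : (|t| ^ (1 + 1 / (n : ℝ))) ^ n = |t| ^ (n + 1) := by
    rw [← Real.rpow_natCast, ← Real.rpow_mul (abs_nonneg t), ← Real.rpow_natCast]
    congr 1
    push_cast
    field_simp
  rw [mul_pow, h1]
  have := Real.exp_le_exp.2 ht
  calc _ ≤ alphaMT (n + 1) ^ n * |t| ^ (n + 1) * Real.exp K := by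
        apply mul_le_mul_of_nonneg_left this (by positivity)
    _ = _ := by ring

theorem energy_lintegral {n : ℕ} (u : MTE n → ℝ) (hu : IsTest (unitBall (n + 1)) u)
    (hE : (∫ x in unitBall (n + 1), ‖fderiv ℝ u x‖ ^ (n + 1)) ≤ 1) :
    ∫⁻ y, ‖fderiv ℝ u y‖ₑ ^ (n + 1) ≤ 1 := by
  obtain ⟨h1, h2, h3⟩ := hu
  have hcf : Continuous (fun y => fderiv ℝ u y) :=
    h1.continuous_fderiv (by simp)
  have hcc : HasCompactSupport (fun y => fderiv ℝ u y) := h2.fderiv ℝ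
  have hsub : Function.support (fun y => ‖fderiv ℝ u y‖ₑ ^ (n + 1)) ⊆ ball 0 1 := by
    intro x hx
    apply h3
    apply support_fderiv_subset ℝ
    intro h0
    apply hx
    simp only [h0]
    rw [enorm_clm_zero, zero_pow (by omega)]
  rw [← setLIntegral_eq_of_support_subset hsub]
  have hintg : Integrable (fun y => ‖fderiv ℝ u y‖ ^ (n + 1)) := by
    apply Continuous.integrable_of_hasCompactSupport (hcf.norm.pow _)
    exact hcc.comp_left (g := fun z => ‖z‖ ^ (n + 1)) (by simp)
  have h := ofReal_integral_eq_lintegral_ofReal (hintg.restrict (s := ball 0 1))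
    (Filter.Eventually.of_forall fun y => by positivity)
  have h' : ∫⁻ y in ball (0 : MTE n) 1, ‖fderiv ℝ u y‖ₑ ^ (n + 1) =
      ∫⁻ y in ball (0 : MTE n) 1, ENNReal.ofReal (‖fderiv ℝ u y‖ ^ (n + 1)) := by
    refine lintegral_congr fun y => ?_
    rw [ENNReal.ofReal_pow (norm_nonneg _), ofReal_norm]
  rw [h', ← h]
  rw [← ENNReal.ofReal_one]
  exact ENNReal.ofReal_le_ofReal hE

theorem forward_mm {n : ℕ} (hn : 1 ≤ n) : ∃ M : ℝ, 0 ≤ M ∧ ∀ (u : MTE n → ℝ),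
    IsTest (unitBall (n + 1)) u → (∫ x in unitBall (n + 1), ‖fderiv ℝ u x‖ ^ (n + 1)) ≤ 1 →
    ∫⁻ x, ENNReal.ofReal (PhiMT (n + 1) (u x)) ∂(mm n) ≤ ENNReal.ofReal M := by
  have hα := alpha_pos n
  obtain ⟨B, hB0, hB⟩ := level_bound hn
  set D := alphaMT (n + 1) ^ n * Real.exp (k0 n) with hD
  have hD0 : 0 ≤ D := by positivity
  refine ⟨D + B + B, by positivity, fun u hu hE => ?_⟩
  have hE' := energy_lintegral u hu hE
  obtain ⟨h1, h2, h3⟩ := hu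
  have hu1 : ContDiff ℝ 1 u := h1.of_le (by exact_mod_cast le_top)
  have hP := (poincare hn u hu1 h3).trans hE'
  have hB1 := hB u hu1 h2 h3 hE'
  have hB2 := hB (fun x => - u x) hu1.neg h2.neg (by
    have : tsupport (fun x => - u x) = tsupport u := by
      unfold tsupport
      congr 1
      ext x; simp
    rw [this]; exact h3) (by
    have : ∀ y, ‖fderiv ℝ (fun x => - u x) y‖ₑ = ‖fderiv ℝ u y‖ₑ := by
      intro y
      rw [fderiv_fun_neg, enorm_neg]
    simp only [this]; exact hE')
  have hm1 : MeasurableSet {x | sl n (k0 n) < u x} :=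
    measurableSet_lt measurable_const hu1.continuous.measurable
  have hm2 : MeasurableSet {x | sl n (k0 n) < - u x} :=
    measurableSet_lt measurable_const hu1.continuous.neg.measurable
  have hmu : Measurable u := hu1.continuous.measurable
  have g1 : Measurable (fun x => ENNReal.ofReal (Real.exp (alphaMT (n + 1) * u x ^ (1 + 1 / (n : ℝ))))) := by
    fun_prop
  have hpt : ∀ x, ENNReal.ofReal (PhiMT (n + 1) (u x)) ≤
      ENNReal.ofReal D * ‖u x‖ₑ ^ (n + 1) +
      ({x | sl n (k0 n) < u x}).indicator
        (fun x => ENNReal.ofReal (Real.exp (alphaMT (n + 1) * u x ^ (1 + 1 / (n : ℝ))))) x +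
      ({x | sl n (k0 n) < - u x}).indicator
        (fun x => ENNReal.ofReal (Real.exp (alphaMT (n + 1) * (- u x) ^ (1 + 1 / (n : ℝ))))) x := by
    intro x
    have hs0 := sl_nonneg n (k := k0 n) (Nat.cast_nonneg _)
    by_cases hx : sl n (k0 n) < u x
    · refine le_trans ?_ (le_add_right (le_add_left le_rfl))
      rw [indicator_of_mem (show x ∈ {x | sl n (k0 n) < u x} from hx)]
      apply ENNReal.ofReal_le_ofReal
      have := Phi_le_exp hn (u x)
      rwa [abs_of_nonneg (hs0.trans hx.le)] at this
    by_cases hx' : sl n (k0 n) < - u x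
    · refine le_trans ?_ (le_add_left le_rfl)
      rw [indicator_of_mem (show x ∈ {x | sl n (k0 n) < - u x} from hx')]
      apply ENNReal.ofReal_le_ofReal
      have := Phi_le_exp hn (u x)
      rwa [abs_of_nonpos (by linarith)] at this
    · refine le_trans ?_ (le_add_right (le_add_right le_rfl))
      have hab : ¬ sl n (k0 n) < |u x| := by
        push Not at hx hx' ⊢
        exact abs_le.2 ⟨by linarith, hx⟩
      rw [lt_sl_iff n (Nat.cast_nonneg _) (abs_nonneg _)] at hab
      push Not at hab
      have := Phi_le_pow hn hab
      refine (ENNReal.ofReal_le_ofReal this).trans (le_of_eq ?_)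
      rw [ENNReal.ofReal_mul hD0, ENNReal.ofReal_pow (abs_nonneg _), ← Real.norm_eq_abs, ofReal_norm]
  have mA : Measurable (fun x => ENNReal.ofReal D * ‖u x‖ₑ ^ (n + 1)) :=
    (hmu.enorm.pow_const _).const_mul _
  refine (lintegral_mono hpt).trans ?_
  have g2 : Measurable (fun x => ENNReal.ofReal (Real.exp (alphaMT (n + 1) * (- u x) ^ (1 + 1 / (n : ℝ))))) := by
    fun_prop
  rw [lintegral_add_right _ (g2.indicator hm2), lintegral_add_left mA,
    lintegral_indicator hm1, lintegral_indicator hm2, lintegral_const_mul _ (hmu.enorm.pow_const _),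
    ENNReal.ofReal_add (by positivity) hB0, ENNReal.ofReal_add hD0 hB0]
  refine add_le_add (add_le_add ?_ hB1) hB2
  calc _ ≤ ENNReal.ofReal D * 1 := by gcongr
    _ = _ := mul_one _

theorem forward {n : ℕ} (hn : 1 ≤ n) (ρ : MTE n → ℝ) (hρpos : ∀ x ∈ unitBall (n + 1), 0 < ρ x)
    (h : ∃ C : ℝ, 0 < C ∧ ∀ x ∈ unitBall (n + 1), ρ x ≤ C / (1 - ‖x‖ ^ 2) ^ 2) :
    BddAbove {r : ℝ | ∃ u : MTE n → ℝ, IsTest (unitBall (n + 1)) u ∧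
        (∫ x in unitBall (n + 1), ‖fderiv ℝ u x‖ ^ (n + 1)) ≤ 1 ∧
        r = ∫ x in unitBall (n + 1), PhiMT (n + 1) (u x) * ρ x ^ (((n + 1 : ℕ) : ℝ) / 2)} := by
  obtain ⟨C, hC, hρ⟩ := h
  obtain ⟨M, hM0, hM⟩ := forward_mm hn
  refine ⟨C ^ (((n + 1 : ℕ) : ℝ) / 2) * M, ?_⟩
  rintro r ⟨u, hu, hE, rfl⟩
  have hm := hM u hu hE
  have hmu : Measurable u := hu.1.continuous.measurable
  have hmP : Measurable (fun x => ENNReal.ofReal (PhiMT (n + 1) (u x))) := by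
    unfold PhiMT
    fun_prop
  rw [lintegral_mm _ hmP] at hm
  refine (le_abs_self _).trans ?_
  rw [← Real.norm_eq_abs, ← ENNReal.ofReal_le_ofReal_iff (by positivity), ofReal_norm]
  refine (enorm_integral_le_lintegral_enorm _).trans ?_
  rw [ENNReal.ofReal_mul (by positivity)]
  refine le_trans ?_ (mul_le_mul_right hm _)
  rw [← lintegral_const_mul _ (by fun_prop)]
  refine setLIntegral_mono' measurableSet_ball fun x hx => ?_
  have hx1 := norm_sq_lt hx
  have hp := hρpos x hx
  have hb := hρ x hx
  have hΦ := Phi_nonneg hn (u x)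
  have hd : 0 < 1 - ‖x‖ ^ 2 := by linarith
  have key : ρ x ^ (((n + 1 : ℕ) : ℝ) / 2) ≤
      C ^ (((n + 1 : ℕ) : ℝ) / 2) * ((1 - ‖x‖ ^ 2) ^ (n + 1))⁻¹ := by
    refine (Real.rpow_le_rpow hp.le hb (by positivity)).trans (le_of_eq ?_)
    rw [Real.div_rpow hC.le (by positivity), div_eq_mul_inv, ← Real.rpow_natCast (1 - ‖x‖ ^ 2) 2,
      ← Real.rpow_mul hd.le, ← Real.rpow_natCast (1 - ‖x‖ ^ 2) (n + 1)]
    congr 3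
    push_cast; ring
  rw [← ofReal_norm, norm_mul, Real.norm_of_nonneg hΦ, Real.norm_of_nonneg (by positivity),
    ← ENNReal.ofReal_mul (by positivity), ← ENNReal.ofReal_mul (by positivity)]
  apply ENNReal.ofReal_le_ofReal
  calc _ ≤ PhiMT (n + 1) (u x) * (C ^ (((n + 1 : ℕ) : ℝ) / 2) * ((1 - ‖x‖ ^ 2) ^ (n + 1))⁻¹) :=
        mul_le_mul_of_nonneg_left key hΦ
    _ = _ := by ring

end MT

namespace MT

theorem exists_profile : ∃ H : ℝ → ℝ, ContDiff ℝ (⊤ : ℕ∞) H ∧ (∀ t ≤ 0, H t = 0) ∧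
    (∀ t, t - 1 ≤ H t) ∧ (∀ t, 0 ≤ H t) ∧ (∀ t, |deriv H t| ≤ 1) ∧ (∀ t ≤ 0, deriv H t = 0) := by
  have hc : Continuous Real.smoothTransition := Real.smoothTransition.continuous
  have hd : ∀ t, HasDerivAt (fun t => ∫ s in (0:ℝ)..t, Real.smoothTransition s)
      (Real.smoothTransition t) t := fun t =>
    intervalIntegral.integral_hasDerivAt_right (hc.intervalIntegrable _ _)
      hc.stronglyMeasurable.stronglyMeasurableAtFilter hc.continuousAt
  have hd' : deriv (fun t => ∫ s in (0:ℝ)..t, Real.smoothTransition s) = Real.smoothTransition :=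
    funext fun t => (hd t).deriv
  have h0 : ∀ t ≤ 0, ∫ s in (0:ℝ)..t, Real.smoothTransition s = 0 := by
    intro t ht
    have : ∫ s in (0:ℝ)..t, Real.smoothTransition s = ∫ s in (0:ℝ)..t, (0:ℝ) := by
      apply intervalIntegral.integral_congr
      intro s hs
      rw [uIcc_of_ge ht] at hs
      exact Real.smoothTransition.zero_of_nonpos hs.2
    rw [this]; simp
  have hnn : ∀ t, 0 ≤ ∫ s in (0:ℝ)..t, Real.smoothTransition s := by
    intro t
    rcases le_total t 0 with ht | ht
    · rw [h0 t ht]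
    · exact intervalIntegral.integral_nonneg ht fun s _ => Real.smoothTransition.nonneg s
  refine ⟨fun t => ∫ s in (0:ℝ)..t, Real.smoothTransition s, ?_, h0, ?_, hnn, ?_, ?_⟩
  · rw [contDiff_infty_iff_deriv, hd']
    exact ⟨fun t => (hd t).differentiableAt, Real.smoothTransition.contDiff⟩
  · intro t
    rcases le_total t 1 with ht | ht
    · have := hnn t; simp only; linarith
    · simp only
      rw [← intervalIntegral.integral_add_adjacent_intervals (b := 1)
        (hc.intervalIntegrable _ _) (hc.intervalIntegrable _ _)]
      have h1 := hnn 1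
      have h2 : ∫ s in (1:ℝ)..t, Real.smoothTransition s = ∫ s in (1:ℝ)..t, (1:ℝ) := by
        apply intervalIntegral.integral_congr
        intro s hs
        rw [uIcc_of_le ht] at hs
        exact Real.smoothTransition.one_of_one_le hs.1
      rw [h2]
      simp only [intervalIntegral.integral_const, smul_eq_mul, mul_one]
      linarith
  · intro t
    rw [hd', abs_of_nonneg (Real.smoothTransition.nonneg t)]
    exact Real.smoothTransition.le_one t
  · intro t ht
    rw [hd']
    exact Real.smoothTransition.zero_of_nonpos ht

theorem radial_int {R δ : ℝ} (hδ : 0 < δ) (hδR : δ < R) :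
    ∫⁻ r in Ioc (0:ℝ) (√(R ^ 2 - δ ^ 2)), ENNReal.ofReal (r / (r ^ 2 + δ ^ 2)) =
      ENNReal.ofReal (Real.log (R / δ)) := by
  set b := √(R ^ 2 - δ ^ 2) with hb
  have hb0 : 0 ≤ b := Real.sqrt_nonneg _
  have hR : 0 < R := hδ.trans hδR
  have hb2 : b ^ 2 = R ^ 2 - δ ^ 2 := Real.sq_sqrt (by nlinarith)
  have hcont : Continuous (fun r : ℝ => r / (r ^ 2 + δ ^ 2)) :=
    continuous_id.div (by fun_prop) fun r => by positivity
  have hintg : IntegrableOn (fun r : ℝ => r / (r ^ 2 + δ ^ 2)) (Ioc 0 b) :=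
    (hcont.integrableOn_Icc).mono_set Ioc_subset_Icc_self
  rw [← ofReal_integral_eq_lintegral_ofReal hintg]
  · congr 1
    rw [← intervalIntegral.integral_of_le hb0]
    have hderiv : ∀ r ∈ uIcc 0 b, HasDerivAt (fun r : ℝ => (1 / 2) * Real.log (r ^ 2 + δ ^ 2))
        (r / (r ^ 2 + δ ^ 2)) r := by
      intro r _
      have h1 : HasDerivAt (fun r : ℝ => r ^ 2 + δ ^ 2) (2 * r) r := by
        simpa using (hasDerivAt_pow 2 r).add_const (δ ^ 2)
      have h2 := (h1.log (by positivity)).const_mul (1 / 2)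
      exact h2.congr_deriv (by ring)
    rw [intervalIntegral.integral_eq_sub_of_hasDerivAt hderiv (hcont.intervalIntegrable _ _), hb2]
    rw [Real.log_div hR.ne' hδ.ne']
    simp only [sub_add_cancel, ne_eq, OfNat.ofNat_ne_zero, not_false_eq_true, zero_pow, zero_add,
      Real.log_pow]
    push_cast
    ring
  · filter_upwards [ae_restrict_mem measurableSet_Ioc] with r hr
    have := hr.1
    simp only [Pi.zero_apply]
    positivity

theorem exp_dom (n : ℕ) : ∃ X0 : ℝ, 0 ≤ X0 ∧ ∀ X, X0 ≤ X →
    Real.exp X / 2 ≤ Real.exp X - ∑ j ∈ Finset.range n, X ^ j / (Nat.factorial j : ℝ) := by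
  have h : Filter.Tendsto (fun X : ℝ => ∑ j ∈ Finset.range n,
      (X ^ j * Real.exp (-X)) / (Nat.factorial j : ℝ)) Filter.atTop (nhds 0) := by
    have := tendsto_finsetSum (Finset.range n) (fun j _ =>
      (Real.tendsto_pow_mul_exp_neg_atTop_nhds_zero j).div_const (Nat.factorial j : ℝ))
    simpa using this
  have h2 := h.eventually (gt_mem_nhds (show (0:ℝ) < 1 / 2 by norm_num))
  obtain ⟨X0, hX0⟩ := Filter.eventually_atTop.1 h2
  refine ⟨max X0 0, le_max_right _ _, fun X hX => ?_⟩
  have h3 := hX0 X ((le_max_left _ _).trans hX)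
  have h4 : ∑ j ∈ Finset.range n, (X ^ j * Real.exp (-X)) / (Nat.factorial j : ℝ) =
      (∑ j ∈ Finset.range n, X ^ j / (Nat.factorial j : ℝ)) * Real.exp (-X) := by
    rw [Finset.sum_mul]
    refine Finset.sum_congr rfl fun j _ => by ring
  rw [h4, Real.exp_neg, ← div_eq_mul_inv, div_lt_iff₀ (Real.exp_pos _)] at h3
  linarith

/-- Height estimate. -/
theorem height {n : ℕ} (hn : 1 ≤ n) {L w : ℝ} (hL : 2 ≤ L)
    (hw : (1 / (sphereVol (n + 1) * L)) ^ (1 / ((n : ℝ) + 1)) * (L - 2) ≤ w) :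
    ((n : ℝ) + 1) * (L - 4) ≤ alphaMT (n + 1) * |w| ^ (1 + 1 / (n : ℝ)) := by
  have hσ := sphereVol_pos n
  have hn1 : (1 : ℝ) ≤ n := by exact_mod_cast hn
  have hn0 : (n : ℝ) ≠ 0 := by positivity
  have hL0 : 0 < L := by linarith
  have hL2 : 0 ≤ L - 2 := by linarith
  set σ := sphereVol (n + 1)
  have hw0 : 0 ≤ w := le_trans (by positivity) hw
  rw [abs_of_nonneg hw0, alpha_eq n]
  have h1 : ((1 / (σ * L)) ^ (1 / ((n : ℝ) + 1)) * (L - 2)) ^ (1 + 1 / (n : ℝ)) ≤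
      w ^ (1 + 1 / (n : ℝ)) := Real.rpow_le_rpow (by positivity) hw (by positivity)
  have h2 : ((1 / (σ * L)) ^ (1 / ((n : ℝ) + 1)) * (L - 2)) ^ (1 + 1 / (n : ℝ)) =
      (σ ^ (1 / (n : ℝ)))⁻¹ * (L * (1 + -(2 / L)) ^ (1 + 1 / (n : ℝ))) := by
    have hb : 0 ≤ 1 + -(2 / L) := by
      have : 2 / L ≤ 1 := (div_le_one hL0).2 hL
      linarith
    have e1 : L - 2 = L * (1 + -(2 / L)) := by field_simp; ring
    rw [e1, Real.mul_rpow (by positivity) (by positivity), Real.mul_rpow hL0.le hb,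
      ← Real.rpow_mul (by positivity)]
    have e2 : 1 / ((n : ℝ) + 1) * (1 + 1 / (n : ℝ)) = 1 / n := by field_simp
    rw [e2, one_div (σ * L), Real.inv_rpow (by positivity), Real.mul_rpow hσ.le hL0.le,
      Real.rpow_add hL0, Real.rpow_one]
    have : L ^ (1 / (n : ℝ)) ≠ 0 := by positivity
    field_simp
  have h3 : 1 + (1 + 1 / (n : ℝ)) * (-(2 / L)) ≤ (1 + -(2 / L)) ^ (1 + 1 / (n : ℝ)) := by
    apply one_add_mul_self_le_rpow_one_add
    · have : 2 / L ≤ 1 := (div_le_one hL0).2 hL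
      linarith
    · have : 0 ≤ 1 / (n : ℝ) := by positivity
      linarith
  have h4 : L - 4 ≤ L * (1 + -(2 / L)) ^ (1 + 1 / (n : ℝ)) := by
    have h5 := mul_le_mul_of_nonneg_left h3 hL0.le
    have h6 : L * (1 + (1 + 1 / (n : ℝ)) * (-(2 / L))) = L - 2 * (1 + 1 / (n : ℝ)) := by
      field_simp; ring
    have h7 : 1 / (n : ℝ) ≤ 1 := by rw [div_le_one (by positivity)]; exact hn1
    linarith
  rw [h2] at h1
  have hs : 0 < σ ^ (1 / (n : ℝ)) := by positivity
  calc ((n : ℝ) + 1) * (L - 4) ≤ ((n : ℝ) + 1) * (L * (1 + -(2 / L)) ^ (1 + 1 / (n : ℝ))) := by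
        gcongr
    _ = ((n : ℝ) + 1) * σ ^ (1 / (n : ℝ)) * ((σ ^ (1 / (n : ℝ)))⁻¹ *
        (L * (1 + -(2 / L)) ^ (1 + 1 / (n : ℝ)))) := by
        field_simp
    _ ≤ _ := by gcongr

end MT

namespace MT

theorem exists_test {n : ℕ} (hn : 1 ≤ n) {x0 : MTE n} {R : ℝ} (hR : 0 < R)
    (hx0 : ‖x0‖ + R < 1) {L : ℝ} (hL : 2 ≤ L) :
    ∃ u : MTE n → ℝ, IsTest (unitBall (n + 1)) u ∧
      (∫ x in unitBall (n + 1), ‖fderiv ℝ u x‖ ^ (n + 1)) ≤ 1 ∧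
      (∀ x, R < dist x x0 → u x = 0) ∧
      (∀ x ∈ ball x0 (R * Real.exp (-L)),
        ((n : ℝ) + 1) * (L - 4) ≤ alphaMT (n + 1) * |u x| ^ (1 + 1 / (n : ℝ))) := by
  obtain ⟨H, hH, hH0, hHl, hHnn, hHd, hHd0⟩ := exists_profile
  have hσ := sphereVol_pos n
  have hL0 : 0 < L := by linarith
  set δ := R * Real.exp (-L) with hδd
  have hδ : 0 < δ := by positivity
  have hδR : δ < R := by
    have : Real.exp (-L) < 1 := (Real.exp_lt_exp.2 (show -L < 0 by linarith)).trans_eq Real.exp_zero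
    nlinarith
  have hlog : Real.log (R / δ) = L := by
    rw [hδd, div_mul_eq_div_div, div_self hR.ne', one_div, ← Real.exp_neg, Real.log_exp, neg_neg]
  set c := (1 / (sphereVol (n + 1) * L)) ^ (1 / ((n : ℝ) + 1)) with hc
  have hc0 : 0 ≤ c := by positivity
  have hcN : c ^ (n + 1) = 1 / (sphereVol (n + 1) * L) := root_pow (by positivity)
  set τ : MTE n → ℝ := fun x => Real.log R - (1 / 2) * Real.log (‖x - x0‖ ^ 2 + δ ^ 2) with hτ
  set u : MTE n → ℝ := fun x => c * H (τ x) with hu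
  have hpos : ∀ x : MTE n, 0 < ‖x - x0‖ ^ 2 + δ ^ 2 := fun x => by positivity
  have hτc : ContDiff ℝ (⊤ : ℕ∞) τ := by
    refine contDiff_const.sub (contDiff_const.mul (ContDiff.log ?_ fun x => (hpos x).ne'))
    exact ((contDiff_id.sub contDiff_const).norm_sq ℝ).add contDiff_const
  have huc : ContDiff ℝ (⊤ : ℕ∞) u := contDiff_const.mul (hH.comp hτc)
  have hτ0 : ∀ x, R ^ 2 ≤ ‖x - x0‖ ^ 2 + δ ^ 2 → τ x ≤ 0 := by
    intro x hx
    have h1 := Real.log_le_log (by positivity) hx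
    rw [Real.log_pow] at h1
    simp only [hτ]
    push_cast at h1
    linarith
  have hu0 : ∀ x, R < dist x x0 → u x = 0 := by
    intro x hx
    rw [dist_eq_norm] at hx
    have : τ x ≤ 0 := hτ0 x (by nlinarith [sq_nonneg δ])
    simp only [hu]
    rw [hH0 _ this, mul_zero]
  have hsupp : tsupport u ⊆ closedBall x0 R := by
    apply closure_minimal _ isClosed_closedBall
    intro x hx
    by_contra h
    rw [mem_closedBall, not_le] at h
    exact hx (hu0 x h)
  have hcb : closedBall x0 R ⊆ ball (0 : MTE n) 1 := by
    intro x hx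
    rw [mem_closedBall, dist_eq_norm] at hx
    rw [mem_ball_zero_iff]
    have : ‖x‖ ≤ ‖x - x0‖ + ‖x0‖ := by
      simpa using norm_add_le (x - x0) x0
    linarith
  have hcs : HasCompactSupport u :=
    HasCompactSupport.of_support_subset_isCompact (isCompact_closedBall x0 R)
      ((subset_tsupport u).trans hsupp)
  have hder : ∀ x, HasFDerivAt u ((c * deriv H (τ x)) • ((-(1 / (‖x - x0‖ ^ 2 + δ ^ 2))) •
      innerSL ℝ (x - x0))) x := by
    intro x
    have h1 : HasFDerivAt (fun x : MTE n => ‖x - x0‖ ^ 2 + δ ^ 2) (2 • innerSL ℝ (x - x0)) x := by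
      have := ((hasFDerivAt_id x).sub_const x0).norm_sq.add_const (δ ^ 2)
      simpa using this
    have h2 : HasFDerivAt τ ((-(1 / (‖x - x0‖ ^ 2 + δ ^ 2))) • innerSL ℝ (x - x0)) x := by
      have h3 := ((h1.log (hpos x).ne').const_mul (1 / 2)).const_sub (Real.log R)
      refine h3.congr_fderiv ?_
      ext v
      simp
      ring
    have h4 : HasDerivAt H (deriv H (τ x)) (τ x) :=
      (hH.differentiable (by simp) _).hasDerivAt
    have h5 := (h4.comp_hasFDerivAt x h2).const_mul c
    refine h5.congr_fderiv ?_
    ext v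
    simp
    ring
  set g : ℝ → ℝ≥0∞ := (Iic (√(R ^ 2 - δ ^ 2))).indicator
    (fun r => ENNReal.ofReal (c ^ (n + 1) * (|r| / (r ^ 2 + δ ^ 2)) ^ (n + 1))) with hg
  have hgm : Measurable g := by
    apply Measurable.indicator _ measurableSet_Iic
    fun_prop
  have hle : ∀ x, ‖fderiv ℝ u x‖ₑ ^ (n + 1) ≤ g ‖x - x0‖ := by
    intro x
    rw [(hder x).fderiv]
    by_cases hx : ‖x - x0‖ ≤ √(R ^ 2 - δ ^ 2)
    · simp only [hg]
      rw [indicator_of_mem (show ‖x - x0‖ ∈ Iic _ from hx), ← ofReal_norm,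
        ← ENNReal.ofReal_pow (norm_nonneg _), ← mul_pow]
      apply ENNReal.ofReal_le_ofReal
      apply pow_le_pow_left₀ (norm_nonneg _)
      rw [norm_smul, norm_smul, innerSL_apply_norm, norm_neg,
        Real.norm_of_nonneg (show 0 ≤ 1 / (‖x - x0‖ ^ 2 + δ ^ 2) by positivity), norm_mul, Real.norm_of_nonneg hc0, abs_norm, Real.norm_eq_abs]
      have h1 := hHd (τ x)
      have h2 : 0 ≤ 1 / (‖x - x0‖ ^ 2 + δ ^ 2) * ‖x - x0‖ := by positivity
      calc _ ≤ c * 1 * (1 / (‖x - x0‖ ^ 2 + δ ^ 2) * ‖x - x0‖) := by gcongr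
        _ = _ := by ring
    · rw [not_le] at hx
      have h1 := Real.lt_sq_of_sqrt_lt hx
      rw [hHd0 _ (hτ0 x (by linarith)), mul_zero, zero_smul, enorm_clm_zero, zero_pow (by omega)]
      exact zero_le
  have hen : ∫⁻ x, ‖fderiv ℝ u x‖ₑ ^ (n + 1) ≤ 1 := by
    refine (lintegral_mono hle).trans ?_
    rw [lintegral_sub_right_eq_self (fun x : MTE n => g ‖x‖) x0, polar_radial n g hgm,
      sphere_total n]
    have h1 : ∫⁻ r in Ioi (0:ℝ), ENNReal.ofReal (r ^ n) * g r ≤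
        ENNReal.ofReal (c ^ (n + 1) * L) := by
      have h2 : ∀ r ∈ Ioi (0:ℝ), ENNReal.ofReal (r ^ n) * g r ≤
          (Iic (√(R ^ 2 - δ ^ 2))).indicator
            (fun r => ENNReal.ofReal (c ^ (n + 1)) * ENNReal.ofReal (r / (r ^ 2 + δ ^ 2))) r := by
        intro r hr
        have hr0 : 0 < r := hr
        simp only [hg]
        by_cases hx : r ∈ Iic (√(R ^ 2 - δ ^ 2))
        · rw [indicator_of_mem hx, indicator_of_mem hx, ← ENNReal.ofReal_mul (by positivity),
            ← ENNReal.ofReal_mul (by positivity)]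
          apply ENNReal.ofReal_le_ofReal
          rw [abs_of_pos hr0]
          have h3 : r ^ n * (r / (r ^ 2 + δ ^ 2)) ^ n ≤ 1 := by
            rw [← mul_pow]
            apply pow_le_one₀ (by positivity)
            rw [← mul_div_assoc, div_le_one (by positivity)]
            nlinarith [sq_nonneg δ]
          calc _ = (c ^ (n + 1) * (r / (r ^ 2 + δ ^ 2))) * (r ^ n * (r / (r ^ 2 + δ ^ 2)) ^ n) := by
                ring
            _ ≤ (c ^ (n + 1) * (r / (r ^ 2 + δ ^ 2))) * 1 := by gcongr
            _ = _ := mul_one _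
        · rw [indicator_of_notMem hx, indicator_of_notMem hx, mul_zero]
      refine (setLIntegral_mono' measurableSet_Ioi h2).trans (le_of_eq ?_)
      rw [setLIntegral_indicator measurableSet_Iic, inter_comm, Ioi_inter_Iic,
        lintegral_const_mul _ (by fun_prop), radial_int hδ hδR, hlog,
        ← ENNReal.ofReal_mul (by positivity)]
    calc _ ≤ ENNReal.ofReal (c ^ (n + 1) * L) * ENNReal.ofReal (sphereVol (n + 1)) := by gcongr
      _ = 1 := by
        rw [← ENNReal.ofReal_mul (by positivity), hcN, ← ENNReal.ofReal_one]
        congr 1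
        field_simp
  refine ⟨u, ⟨huc, hcs, hsupp.trans hcb⟩, ?_, hu0, ?_⟩
  · have hcf : Continuous (fun y => fderiv ℝ u y) := huc.continuous_fderiv (by simp)
    have hcf2 : Continuous (fun y => ‖fderiv ℝ u y‖ ^ (n + 1)) := hcf.norm.pow _
    rw [integral_eq_lintegral_of_nonneg_ae (f := fun y => ‖fderiv ℝ u y‖ ^ (n + 1))
      (Filter.Eventually.of_forall fun y => pow_nonneg (norm_nonneg _) _)
      hcf2.aestronglyMeasurable]
    apply ENNReal.toReal_le_of_le_ofReal zero_le_one
    rw [ENNReal.ofReal_one]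
    refine le_trans ?_ ((setLIntegral_le_lintegral (unitBall (n + 1)) _).trans hen)
    refine le_of_eq (lintegral_congr fun y => ?_)
    rw [ENNReal.ofReal_pow (norm_nonneg _), ofReal_norm]
  · intro x hx
    apply height hn hL
    apply mul_le_mul_of_nonneg_left _ hc0
    refine le_trans ?_ (hHl _)
    rw [mem_ball, dist_eq_norm] at hx
    have h1 : ‖x - x0‖ ^ 2 + δ ^ 2 ≤ 2 * δ ^ 2 := by nlinarith [norm_nonneg (x - x0)]
    have h2 := Real.log_le_log (hpos x) h1
    rw [Real.log_mul (by norm_num) (by positivity), Real.log_pow] at h2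
    rw [Real.log_div hR.ne' hδ.ne'] at hlog
    have h3 := Real.log_two_lt_d9
    simp only [hτ]
    push_cast at h2
    linarith

end MT

namespace MT

theorem Phi_zero {n : ℕ} (hn : 1 ≤ n) : PhiMT (n + 1) 0 = 0 := by
  apply le_antisymm _ (Phi_nonneg hn 0)
  have := Phi_le_pow hn (t := 0) le_rfl
  simpa using this

theorem Phi_continuous {n : ℕ} (hn : 1 ≤ n) : Continuous (PhiMT (n + 1)) := by
  have hq : 0 ≤ 1 + 1 / (n : ℝ) := by positivity
  have h : PhiMT (n + 1) = fun t => Real.exp (alphaMT (n + 1) * |t| ^ (1 + 1 / (n : ℝ))) -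
      ∑ j ∈ Finset.range n, (alphaMT (n + 1) * |t| ^ (1 + 1 / (n : ℝ))) ^ j / (Nat.factorial j : ℝ) :=
    funext fun t => Phi_eq hn t
  have h1 : Continuous (fun t : ℝ => alphaMT (n + 1) * |t| ^ (1 + 1 / (n : ℝ))) :=
    continuous_const.mul (continuous_abs.rpow_const fun t => Or.inr hq)
  rw [h]
  refine (Real.continuous_exp.comp h1).sub (continuous_finsetSum _ fun j _ => ?_)
  exact (h1.pow j).div_const _

theorem backward_pt {n : ℕ} (hn : 1 ≤ n) (ρ : MTE n → ℝ)
    (hρc : ContinuousOn ρ (unitBall (n + 1))) (hρpos : ∀ x ∈ unitBall (n + 1), 0 < ρ x)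
    {S : ℝ} (hS : ∀ u : MTE n → ℝ, IsTest (unitBall (n + 1)) u →
        (∫ x in unitBall (n + 1), ‖fderiv ℝ u x‖ ^ (n + 1)) ≤ 1 →
        ∫ x in unitBall (n + 1), PhiMT (n + 1) (u x) * ρ x ^ (((n + 1 : ℕ) : ℝ) / 2) ≤ S)
    {x0 : MTE n} (hx0 : x0 ∈ unitBall (n + 1)) {R : ℝ} (hR : 0 < R) (hx0R : ‖x0‖ + R < 1) :
    (Real.exp (-(4 * ((n : ℝ) + 1))) / 2 * (volume (ball (0 : MTE n) 1)).toReal) *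
      (R ^ (n + 1) * (ρ x0 / 2) ^ (((n + 1 : ℕ) : ℝ) / 2)) ≤ S := by
  obtain ⟨X0, hX00, hX0⟩ := exp_dom n
  have hρ0 := hρpos x0 hx0
  have hopen : IsOpen (unitBall (n + 1)) := isOpen_ball
  have hcat : ContinuousAt ρ x0 := hρc.continuousAt (hopen.mem_nhds hx0)
  obtain ⟨ε, hε, hball⟩ := Metric.eventually_nhds_iff.1
    (hcat.eventually (lt_mem_nhds (show ρ x0 / 2 < ρ x0 by linarith)))
  have hlim : Filter.Tendsto (fun L : ℝ => R * Real.exp (-L)) Filter.atTop (nhds 0) := by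
    have := (Real.tendsto_exp_neg_atTop_nhds_zero).const_mul R
    simpa using this
  obtain ⟨L, ⟨hL1, hL2⟩, hLε⟩ := (((Filter.eventually_ge_atTop 2).and
    (Filter.eventually_ge_atTop (X0 + 4))).and (hlim.eventually (gt_mem_nhds hε))).exists
  obtain ⟨u, hu, hE, hu0, huh⟩ := exists_test hn hR hx0R hL1
  refine le_trans ?_ (hS u hu hE)
  set δ := R * Real.exp (-L) with hδd
  have hδ : 0 < δ := by positivity
  have hδR : δ < R := by
    have : Real.exp (-L) < 1 := (Real.exp_lt_exp.2 (show -L < 0 by linarith)).trans_eq Real.exp_zero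
    nlinarith
  have hcb : closedBall x0 R ⊆ unitBall (n + 1) := by
    intro x hx
    rw [mem_closedBall, dist_eq_norm] at hx
    show x ∈ ball (0 : MTE n) 1
    rw [mem_ball_zero_iff]
    have : ‖x‖ ≤ ‖x - x0‖ + ‖x0‖ := by
      simpa using norm_add_le (x - x0) x0
    linarith
  have hsub : ball x0 δ ⊆ unitBall (n + 1) :=
    (ball_subset_closedBall.trans (closedBall_subset_closedBall hδR.le)).trans hcb
  set f : MTE n → ℝ := fun x => PhiMT (n + 1) (u x) * ρ x ^ (((n + 1 : ℕ) : ℝ) / 2) with hf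
  have hfnn : ∀ x ∈ unitBall (n + 1), 0 ≤ f x := fun x hx =>
    mul_nonneg (Phi_nonneg hn _) (Real.rpow_nonneg (hρpos x hx).le _)
  have hfi : IntegrableOn f (unitBall (n + 1)) := by
    have h1 : IntegrableOn f (closedBall x0 R) := by
      apply ContinuousOn.integrableOn_compact (isCompact_closedBall x0 R)
      refine (((Phi_continuous hn).comp hu.1.continuous).continuousOn).mul ?_
      exact (hρc.mono hcb).rpow_const fun x hx => Or.inl (hρpos x (hcb hx)).ne'
    refine h1.of_forall_sdiff_eq_zero measurableSet_ball fun x hx => ?_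
    have h2 : R < dist x x0 := by
      have := hx.2
      rwa [mem_closedBall, not_le] at this
    simp only [hf]
    rw [hu0 x h2, Phi_zero hn, zero_mul]
  have hge : ∀ x ∈ ball x0 δ, Real.exp (((n : ℝ) + 1) * (L - 4)) / 2 *
      (ρ x0 / 2) ^ (((n + 1 : ℕ) : ℝ) / 2) ≤ f x := by
    intro x hx
    have h1 := huh x hx
    have hn1 : (1 : ℝ) ≤ (n : ℝ) + 1 := by
      have : (0 : ℝ) ≤ n := Nat.cast_nonneg n
      linarith
    have h2 : X0 ≤ alphaMT (n + 1) * |u x| ^ (1 + 1 / (n : ℝ)) := by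
      refine le_trans ?_ h1
      have : 0 ≤ L - 4 := by linarith
      nlinarith
    have h3 := hX0 _ h2
    rw [← Phi_eq hn] at h3
    have h4 := Real.exp_le_exp.2 h1
    have h5 : ρ x0 / 2 ≤ ρ x := (hball (lt_trans hx hLε)).le
    have h6 : (ρ x0 / 2) ^ (((n + 1 : ℕ) : ℝ) / 2) ≤ ρ x ^ (((n + 1 : ℕ) : ℝ) / 2) :=
      Real.rpow_le_rpow (by linarith) h5 (by positivity)
    exact mul_le_mul (by linarith) h6 (by positivity) (Phi_nonneg hn _)
  have hvol : (volume (ball x0 δ)).toReal = δ ^ (n + 1) * (volume (ball (0 : MTE n) 1)).toReal := by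
    rw [Measure.addHaar_ball _ _ hδ.le, ENNReal.toReal_mul, ENNReal.toReal_ofReal (by positivity),
      finrank_euclideanSpace_fin]
  have hexp : Real.exp (((n : ℝ) + 1) * (L - 4)) * δ ^ (n + 1) =
      Real.exp (-(4 * ((n : ℝ) + 1))) * R ^ (n + 1) := by
    rw [hδd, mul_pow, ← Real.exp_nat_mul]
    rw [show ((n : ℝ) + 1) * (L - 4) = -(4 * ((n : ℝ) + 1)) + ((n : ℝ) + 1) * L by ring, Real.exp_add]
    have : Real.exp (((n : ℝ) + 1) * L) * Real.exp (((n + 1 : ℕ) : ℝ) * -L) = 1 := by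
      rw [← Real.exp_add, Real.exp_eq_one_iff]
      push_cast; ring
    linear_combination Real.exp (-(4 * ((n : ℝ) + 1))) * R ^ (n + 1) * this
  calc _ = Real.exp (((n : ℝ) + 1) * (L - 4)) / 2 *
      (ρ x0 / 2) ^ (((n + 1 : ℕ) : ℝ) / 2) * (volume (ball x0 δ)).toReal := by
        rw [hvol]
        linear_combination (-(1:ℝ) / 2 * (ρ x0 / 2) ^ (((n + 1 : ℕ) : ℝ) / 2) *
          (volume (ball (0 : MTE n) 1)).toReal) * hexp
    _ ≤ ∫ x in ball x0 δ, f x :=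
        setIntegral_ge_of_const_le_real measurableSet_ball measure_ball_lt_top.ne hge (hfi.mono_set hsub)
    _ ≤ ∫ x in unitBall (n + 1), f x := by
        apply setIntegral_mono_set hfi _ (HasSubset.Subset.eventuallyLE hsub)
        filter_upwards [ae_restrict_mem measurableSet_ball] with x hx
        exact hfnn x hx

theorem backward {n : ℕ} (hn : 1 ≤ n) (ρ : MTE n → ℝ)
    (hρc : ContinuousOn ρ (unitBall (n + 1))) (hρpos : ∀ x ∈ unitBall (n + 1), 0 < ρ x)
    (h : BddAbove {r : ℝ | ∃ u : MTE n → ℝ, IsTest (unitBall (n + 1)) u ∧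
        (∫ x in unitBall (n + 1), ‖fderiv ℝ u x‖ ^ (n + 1)) ≤ 1 ∧
        r = ∫ x in unitBall (n + 1), PhiMT (n + 1) (u x) * ρ x ^ (((n + 1 : ℕ) : ℝ) / 2)}) :
    ∃ C : ℝ, 0 < C ∧ ∀ x ∈ unitBall (n + 1), ρ x ≤ C / (1 - ‖x‖ ^ 2) ^ 2 := by
  obtain ⟨S, hS⟩ := h
  set κ := Real.exp (-(4 * ((n : ℝ) + 1))) / 2 * (volume (ball (0 : MTE n) 1)).toReal with hκ
  have hκ0 : 0 < κ := by
    have : 0 < (volume (ball (0 : MTE n) 1)).toReal :=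
      ENNReal.toReal_pos (measure_ball_pos _ _ one_pos).ne' measure_ball_lt_top.ne
    positivity
  set Q := (max S 0 / κ) ^ (2 / ((n : ℝ) + 1)) with hQ
  have hQ0 : 0 ≤ Q := by positivity
  refine ⟨32 * Q + 1, by positivity, fun x hx => ?_⟩
  have hx1 : ‖x‖ < 1 := by
    have : x ∈ ball (0 : MTE n) 1 := hx
    rwa [mem_ball_zero_iff] at this
  have hxn := norm_nonneg x
  set R := (1 - ‖x‖) / 2 with hR
  have hR0 : 0 < R := by rw [hR]; linarith
  have hρ0 := hρpos x hx
  have key := backward_pt hn ρ hρc hρpos (S := S)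
    (fun u hu hE => hS ⟨u, hu, hE, rfl⟩) hx hR0 (by rw [hR]; linarith)
  rw [← hκ] at key
  have h1 : R ^ (n + 1) * (ρ x / 2) ^ (((n + 1 : ℕ) : ℝ) / 2) ≤ max S 0 / κ := by
    rw [le_div_iff₀ hκ0, mul_comm]
    exact key.trans (le_max_left _ _)
  have h2 : R ^ 2 * (ρ x / 2) ≤ Q := by
    have h3 := Real.rpow_le_rpow (by positivity) h1 (show 0 ≤ 2 / ((n : ℝ) + 1) by positivity)
    refine le_trans (le_of_eq ?_) h3
    rw [Real.mul_rpow (by positivity) (by positivity), ← Real.rpow_natCast R (n + 1),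
      ← Real.rpow_mul hR0.le, ← Real.rpow_mul (by positivity)]
    push_cast
    have e1 : ((n : ℝ) + 1) * (2 / ((n : ℝ) + 1)) = ((2 : ℕ) : ℝ) := by
      push_cast; field_simp
    have e2 : ((n : ℝ) + 1) / 2 * (2 / ((n : ℝ) + 1)) = 1 := by field_simp
    rw [e1, e2, Real.rpow_one, Real.rpow_natCast]
  have hd : 0 < 1 - ‖x‖ ^ 2 := by nlinarith
  rw [le_div_iff₀ (by positivity)]
  have h4 : (1 - ‖x‖ ^ 2) ^ 2 ≤ 16 * R ^ 2 := by
    have : 1 - ‖x‖ ^ 2 ≤ 4 * R := by rw [hR]; nlinarith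
    nlinarith
  have := mul_le_mul_of_nonneg_left h4 hρ0.le
  nlinarith

end MT

end MTHelpers

/-- For a conformal metric `g_ρ = ρ g_e` on the unit ball `B ⊂ ℝ^N` (`ρ` continuous and
positive), the following are equivalent: `ρ` is bounded by the hyperbolic metric, i.e.
`ρ(x) ≤ C/(1-|x|²)²` for some `C > 0`; and the Moser–Trudinger inequality holds for `(B, g_ρ)`,
expressed in Euclidean terms via the conformal invariance of the `N`-Dirichlet energy. -/
theorem moser_trudinger_conformal_iff_bounded_by_hyperbolic (N : ℕ) (hN : 2 ≤ N)
    (ρ : EuclideanSpace ℝ (Fin N) → ℝ)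
    (hρc : ContinuousOn ρ (unitBall N)) (hρpos : ∀ x ∈ unitBall N, 0 < ρ x) :
    (∃ C : ℝ, 0 < C ∧ ∀ x ∈ unitBall N, ρ x ≤ C / (1 - ‖x‖ ^ 2) ^ 2) ↔
      BddAbove {r : ℝ | ∃ u : EuclideanSpace ℝ (Fin N) → ℝ, IsTest (unitBall N) u ∧
        (∫ x in unitBall N, ‖fderiv ℝ u x‖ ^ N) ≤ 1 ∧
        r = ∫ x in unitBall N, PhiMT N (u x) * ρ x ^ ((N : ℝ) / 2)} := by
  obtain ⟨n, rfl⟩ : ∃ n, N = n + 1 := ⟨N - 1, by omega⟩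
  have hn : 1 ≤ n := by omega
  exact ⟨fun h => MT.forward hn ρ hρpos h, fun h => MT.backward hn ρ hρc hρpos h⟩
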